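/- arXiv:math/0110317 — 2 statements merged into one kernel-verified Lean document; each statement's English description precedes it below -/
import Mathlib

section
/- Small-gain theorem, additive form. Let 𝒯 be an additive subgroup of ℝ, 𝒰 a set of inputs, and μᵃ, μᵇ input measures. Suppose given a class-𝒦𝓛 function β, a number r₀ ≥ 0, a class-𝒦 function γ and a class-𝒦∞ function ρ with γ(r) + ρ(γ(r)) < r for all r > r₀, class-𝒦 functions σ₁, σ₂, σ₃, and constants d ≥ 0 and C ≥ 0. Let S be a set of trajectories such that every (τ,u,x,y) ∈ S satisfies: (H1') for each t₀ ∈ [0,τ) and each t ∈ [t₀,τ), y(t) ≤ β(x(t₀), t−t₀) + γ(‖y‖_{[t₀,t]}) + μᵃ(u,t₀,t) + C; and (H2) for each t₀ ∈ [0,τ) and each t ∈ [t₀,τ), x(t) ≤ max{σ₁(x(t₀)), σ₂(t−t₀), σ₃(‖y‖_{[t₀,t]}), μᵇ(u,t₀,t), d}. Then there exists a class-𝒦𝓛 function β̃ such that every trajectory (τ,u,x,y) ∈ S satisfies, for each t₀ ∈ [0,τ) and each t ∈ [t₀,τ): y(t) ≤ max{β̃(x(t₀), t−t₀), μᵐ(u,t₀,t),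 3α(C), 3r₀}, where α(s) := max{4ρ⁻¹(3s), 4s} and μᵐ(u,a,b) := max{α(β(σ₃(α(μᵃ(u,a,b))), 0)), α(β(μᵇ(u,a,b), 0)), α(μᵃ(u,a,b))}. -/
open Set Filter

/-- A function of class 𝒦: continuous, strictly increasing on `[0,∞)`, zero at zero,
and nonnegative on `[0,∞)`. -/
def ClassK (γ : ℝ → ℝ) : Prop :=
  ContinuousOn γ (Ici 0) ∧ StrictMonoOn γ (Ici 0) ∧ γ 0 = 0 ∧ ∀ s, 0 ≤ s → 0 ≤ γ s

/-- A function of class 𝒦∞: class 𝒦 and unbounded. -/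
def ClassKInf (γ : ℝ → ℝ) : Prop :=
  ClassK γ ∧ Tendsto γ atTop atTop

/-- A function of class 𝒦𝓛. -/
def ClassKL (β : ℝ → ℝ → ℝ) : Prop :=
  (∀ t, 0 ≤ t → ClassK (fun s => β s t)) ∧
  (∀ s, 0 ≤ s → ContinuousOn (β s) (Ici 0) ∧ AntitoneOn (β s) (Ici 0) ∧
    Tendsto (β s) atTop (nhds 0))

/-- An input measure on the set of inputs `U`: nonnegative, and monotone as a set
function on finite subintervals of `[0,∞)`. -/
def InputMeasure {U : Type*} (μ : U → ℝ → ℝ → ℝ) : Prop :=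
  (∀ u a b, 0 ≤ a → 0 ≤ b → 0 ≤ μ u a b) ∧
  (∀ u a b c d, 0 ≤ a → a ≤ b → b ≤ c → c ≤ d → μ u b c ≤ μ u a d)

/-- The sup norm of `y` over the interval `[a,b]` intersected with the time set `𝒯`. -/
noncomputable def supT (𝒯 : AddSubgroup ℝ) (y : ℝ → ℝ) (a b : ℝ) : ℝ :=
  sSup (y '' {t : ℝ | t ∈ 𝒯 ∧ t ∈ Icc a b})

/-- `(τ, u, x, y)` is a trajectory: `0 < τ ≤ ∞`, `x` and `y` map `[0,τ)` (intersected
with the time set `𝒯`) into `[0,∞)`, and `y` is bounded on every interval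
`[a,b] ⊆ [0,τ)`. -/
def IsTraj (𝒯 : AddSubgroup ℝ) (τ : EReal) (x y : ℝ → ℝ) : Prop :=
  0 < τ ∧
  (∀ t : ℝ, t ∈ 𝒯 → 0 ≤ t → (t : EReal) < τ → 0 ≤ x t ∧ 0 ≤ y t) ∧
  (∀ a b : ℝ, 0 ≤ a → a ≤ b → (b : EReal) < τ →
    BddAbove (y '' {t : ℝ | t ∈ 𝒯 ∧ t ∈ Icc a b}))

/-- Hypothesis (H1) for the trajectory `(τ, u, x, y)`. -/
def H1 (𝒯 : AddSubgroup ℝ) {U : Type*} (μa : U → ℝ → ℝ → ℝ) (β : ℝ → ℝ → ℝ)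
    (γ : ℝ → ℝ) (C : ℝ) (τ : EReal) (u : U) (x y : ℝ → ℝ) : Prop :=
  ∀ t0 t : ℝ, t0 ∈ 𝒯 → t ∈ 𝒯 → 0 ≤ t0 → t0 ≤ t → (t : EReal) < τ →
    y t ≤ max (max (β (x t0) (t - t0)) (γ (supT 𝒯 y t0 t))) (max (μa u t0 t) C)

/-- Hypothesis (H2) for the trajectory `(τ, u, x, y)`. -/
def H2 (𝒯 : AddSubgroup ℝ) {U : Type*} (μb : U → ℝ → ℝ → ℝ)
    (σ1 σ2 σ3 : ℝ → ℝ) (d : ℝ) (τ : EReal) (u : U) (x y : ℝ → ℝ) : Prop :=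
  ∀ t0 t : ℝ, t0 ∈ 𝒯 → t ∈ 𝒯 → 0 ≤ t0 → t0 ≤ t → (t : EReal) < τ →
    x t ≤ max (max (σ1 (x t0)) (σ2 (t - t0)))
      (max (σ3 (supT 𝒯 y t0 t)) (max (μb u t0 t) d))

/-- Hypothesis (H1'), the additive form of (H1), for the trajectory `(τ, u, x, y)`. -/
def H1' (𝒯 : AddSubgroup ℝ) {U : Type*} (μa : U → ℝ → ℝ → ℝ) (β : ℝ → ℝ → ℝ)
    (γ : ℝ → ℝ) (C : ℝ) (τ : EReal) (u : U) (x y : ℝ → ℝ) : Prop :=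
  ∀ t0 t : ℝ, t0 ∈ 𝒯 → t ∈ 𝒯 → 0 ≤ t0 → t0 ≤ t → (t : EReal) < τ →
    y t ≤ β (x t0) (t - t0) + γ (supT 𝒯 y t0 t) + μa u t0 t + C

theorem SG_contOn_of_locLip (f : ℝ → ℝ)
    (h : ∀ x0, 0 ≤ x0 → ∃ K, 0 ≤ K ∧ ∀ a b, 0 ≤ a → a ≤ b → b ≤ x0 + 1 → |f b - f a| ≤ K * (b - a)) :
    ContinuousOn f (Ici 0) := by
  intro x0 hx0
  obtain ⟨K, hK, h⟩ := h x0 hx0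
  rw [Metric.continuousWithinAt_iff]
  intro ε hε
  refine ⟨min 1 (ε / (K + 1)), by positivity, ?_⟩
  intro x hx hd
  rw [Real.dist_eq] at hd ⊢
  have h1 : |x - x0| < 1 := lt_of_lt_of_le hd (min_le_left _ _)
  have h2 : |x - x0| < ε / (K + 1) := lt_of_lt_of_le hd (min_le_right _ _)
  rw [lt_div_iff₀ (by positivity)] at h2
  have key : |f x - f x0| ≤ K * |x - x0| := by
    rcases le_total x x0 with hle | hle
    · rw [abs_sub_comm, abs_sub_comm x x0, abs_of_nonneg (sub_nonneg.2 hle)]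
      exact h x x0 hx hle (by linarith)
    · rw [abs_of_nonneg (sub_nonneg.2 hle)] at h1 ⊢
      exact h x0 x hx0 hle (by linarith)
  nlinarith [abs_nonneg (x - x0)]

theorem SG_KL_majorant (g : ℝ → ℝ → ℝ) (κ : ℝ → ℝ) (hκ : ClassK κ)
    (h0 : ∀ s T, 0 ≤ g s T)
    (hmono : ∀ s s' T T', s ≤ s' → T' ≤ T → g s T ≤ g s' T')
    (hle : ∀ s T, 0 ≤ s → g s T ≤ κ s)
    (hlim : ∀ s, 0 ≤ s → Tendsto (g s) atTop (nhds 0)) :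
    ∃ βt : ℝ → ℝ → ℝ, ClassKL βt ∧ ∀ s T, 0 ≤ s → g s T ≤ βt s T := by
  obtain ⟨hκc, hκm, hκ0, hκn⟩ := hκ
  set F : ℝ → ℝ → Icc (0:ℝ) 1 → ℝ := fun s T q => (1 - q.1) * g (s + q.1) (T - q.1) with hF
  have hFle : ∀ s T q, F s T q ≤ g (s + 1) (T - 1) := by
    intro s T q
    have hq := q.2
    have h1 := hmono (s + q.1) (s + 1) (T - q.1) (T - 1) (by linarith [hq.2]) (by linarith [hq.2])
    have h2 := h0 (s + q.1) (T - q.1)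
    simp only [hF]
    nlinarith [hq.1, hq.2]
  have hbdd : ∀ s T, BddAbove (range (F s T)) := by
    intro s T
    refine ⟨g (s + 1) (T - 1), ?_⟩
    rintro _ ⟨q, rfl⟩
    exact hFle s T q
  set w : ℝ → ℝ → ℝ := fun s T => ⨆ q, F s T q with hw
  have hFw : ∀ s T q, F s T q ≤ w s T := fun s T q => le_ciSup (hbdd s T) q
  have hwle : ∀ s T B, (∀ q, F s T q ≤ B) → w s T ≤ B := fun s T B h => ciSup_le h
  have hgw : ∀ s T, g s T ≤ w s T := by
    intro s T
    have := hFw s T ⟨0, by simp⟩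
    simpa [hF] using this
  have hw0 : ∀ s T, 0 ≤ w s T := fun s T => (h0 s T).trans (hgw s T)
  have hwm : ∀ s s' T T', s ≤ s' → T' ≤ T → w s T ≤ w s' T' := by
    intro s s' T T' hs hT
    apply hwle
    intro q
    refine le_trans ?_ (hFw s' T' q)
    have hq := q.2
    exact mul_le_mul_of_nonneg_left (hmono _ _ _ _ (by linarith) (by linarith)) (by linarith [hq.2])
  have hkey : ∀ s T e, 0 ≤ e → w (s + e) (T - e) ≤ w s T + e * g (s + e + 1) (T - e - 1) := by
    intro s T e he
    apply hwle
    rintro ⟨q, hq0, hq1⟩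
    have h1 := hmono (s + e + q) (s + e + 1) (T - e - q) (T - e - 1) (by linarith) (by linarith)
    have h2 := h0 (s + e + q) (T - e - q)
    simp only [hF]
    rcases le_total (q + e) 1 with h | h
    · have h3 := hFw s T ⟨q + e, by linarith, h⟩
      simp only [hF] at h3
      rw [show s + (q + e) = s + e + q by ring, show T - (q + e) = T - e - q by ring] at h3
      nlinarith
    · nlinarith [hw0 s T]
  have hκmono : ∀ a b, 0 ≤ a → a ≤ b → κ a ≤ κ b := fun a b ha hab =>
    hκm.monotoneOn ha (ha.trans hab : (0:ℝ) ≤ b) hab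
  have hexp : ∀ T : ℝ, 0 < Real.exp (-T) := fun T => Real.exp_pos _
  refine ⟨fun s T => min (κ s) (w s T) + s * Real.exp (-T), ⟨?_, ?_⟩, ?_⟩
  · intro T hT
    refine ⟨?_, ?_, ?_, ?_⟩
    · refine ContinuousOn.add (ContinuousOn.inf hκc ?_) (by fun_prop)
      apply SG_contOn_of_locLip
      intro s0 hs0
      refine ⟨κ (s0 + 2), hκn _ (by linarith), ?_⟩
      intro a b ha hab hb
      have e1 := hwm a b T T hab le_rfl
      have e2 := hwm b b T (T - (b - a)) le_rfl (by linarith)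
      have e3 := hkey a T (b - a) (by linarith)
      rw [show a + (b - a) = b by ring] at e3
      have e4 := hle (b + 1) (T - (b - a) - 1) (by linarith)
      have e5 := hκmono (b + 1) (s0 + 2) (by linarith) (by linarith)
      rw [abs_of_nonneg (by linarith)]
      nlinarith
    · intro a ha b hb hab
      have e1 := hκmono a b ha hab.le
      have e2 := hwm a b T T hab.le le_rfl
      have e3 : a * Real.exp (-T) < b * Real.exp (-T) := mul_lt_mul_of_pos_right hab (hexp T)
      have := min_le_min e1 e2
      simp only
      linarith
    · simp [hκ0, hw0]
    · intro s hs
      have := hexp T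
      have := le_min (hκn s hs) (hw0 s T)
      have : 0 ≤ s * Real.exp (-T) := by positivity
      simp only
      linarith
  · intro s hs
    refine ⟨?_, ?_, ?_⟩
    · refine ContinuousOn.add (ContinuousOn.inf continuousOn_const ?_) (by fun_prop)
      apply SG_contOn_of_locLip
      intro T0 hT0
      refine ⟨κ (s + T0 + 2), hκn _ (by linarith), ?_⟩
      intro a b ha hab hb
      have e1 := hwm s s b a le_rfl hab
      have e2 := hwm s (s + (b - a)) a a (by linarith) le_rfl
      have e3 := hkey s b (b - a) (by linarith)
      rw [show b - (b - a) = a by ring] at e3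
      have e4 := hle (s + (b - a) + 1) (a - 1) (by linarith)
      have e5 := hκmono (s + (b - a) + 1) (s + T0 + 2) (by linarith) (by linarith)
      rw [abs_sub_comm, abs_of_nonneg (by linarith)]
      nlinarith
    · intro a ha b hb hab
      have e1 := hwm s s b a le_rfl hab
      have e2 : Real.exp (-b) ≤ Real.exp (-a) := Real.exp_le_exp.2 (by linarith)
      have e3 := mul_le_mul_of_nonneg_left e2 hs
      have := min_le_min (le_refl (κ s)) e1
      simp only
      linarith
    · have l1 : Tendsto (fun T => g (s + 1) (T - 1) + s * Real.exp (-T)) atTop (nhds (0 + s * 0)) := by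
        refine Tendsto.add ?_ (Tendsto.const_mul _ ?_)
        · exact (hlim (s + 1) (by linarith)).comp (tendsto_atTop_add_const_right _ (-1) tendsto_id)
        · exact Real.tendsto_exp_neg_atTop_nhds_zero
      rw [mul_zero, add_zero] at l1
      refine squeeze_zero (fun T => ?_) (fun T => ?_) l1
      · have := le_min (hκn s hs) (hw0 s T)
        have : 0 ≤ s * Real.exp (-T) := mul_nonneg hs (hexp T).le
        linarith
      · have := min_le_right (κ s) (w s T)
        have := hwle s T _ (hFle s T)
        linarith
  · intro s T hs
    have := le_min (hle s T hs) (hgw s T)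
    have : 0 ≤ s * Real.exp (-T) := mul_nonneg hs (hexp T).le
    simp only
    linarith

theorem SG_max {U : Type*} (𝒯 : AddSubgroup ℝ)
    (μa μb : U → ℝ → ℝ → ℝ) (hμa : InputMeasure μa) (hμb : InputMeasure μb)
    (β : ℝ → ℝ → ℝ) (hβ : ClassKL β)
    (r0 : ℝ) (hr0 : 0 ≤ r0)
    (γ : ℝ → ℝ) (hγ : ClassK γ)
    (hγr : ∀ r, r0 < r → γ r < r)
    (σ1 σ2 σ3 : ℝ → ℝ) (hσ1 : ClassK σ1) (hσ3 : ClassK σ3)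
    (d : ℝ) (hd : 0 ≤ d) (C : ℝ) (hC : 0 ≤ C)
    (S : Set (EReal × U × (ℝ → ℝ) × (ℝ → ℝ)))
    (hS : ∀ τ u x y, (τ, u, x, y) ∈ S → IsTraj 𝒯 τ x y)
    (hH1 : ∀ τ u x y, (τ, u, x, y) ∈ S → H1 𝒯 μa β γ C τ u x y)
    (hH2 : ∀ τ u x y, (τ, u, x, y) ∈ S → H2 𝒯 μb σ1 σ2 σ3 d τ u x y) :
    ∃ βt : ℝ → ℝ → ℝ, ClassKL βt ∧
      ∀ τ u x y, (τ, u, x, y) ∈ S →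
        ∀ t0 t : ℝ, t0 ∈ 𝒯 → t ∈ 𝒯 → 0 ≤ t0 → t0 ≤ t → (t : EReal) < τ →
          y t ≤ max (max (βt (x t0) (t - t0))
              (max (max (β (σ3 (μa u t0 t)) 0) (β (μb u t0 t) 0)) (μa u t0 t)))
            (max (3 * C) (3 * r0)) := by
  obtain ⟨hγc, hγm, hγ0, hγn⟩ := hγ
  have hγmono : ∀ a b, 0 ≤ a → a ≤ b → γ a ≤ γ b := fun a b ha hab =>
    hγm.monotoneOn ha (ha.trans hab : (0:ℝ) ≤ b) hab
  have hσ1mono : ∀ a b, 0 ≤ a → a ≤ b → σ1 a ≤ σ1 b := fun a b ha hab =>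
    hσ1.2.1.monotoneOn ha (ha.trans hab : (0:ℝ) ≤ b) hab
  have hσ3mono : ∀ a b, 0 ≤ a → a ≤ b → σ3 a ≤ σ3 b := fun a b ha hab =>
    hσ3.2.1.monotoneOn ha (ha.trans hab : (0:ℝ) ≤ b) hab
  have hσ3n := hσ3.2.2.2
  have hβmono : ∀ T, 0 ≤ T → ∀ a b, 0 ≤ a → a ≤ b → β a T ≤ β b T := fun T hT a b ha hab =>
    (hβ.1 T hT).2.1.monotoneOn ha (ha.trans hab : (0:ℝ) ≤ b) hab
  have hβanti : ∀ s, 0 ≤ s → ∀ T, 0 ≤ T → β s T ≤ β s 0 := fun s hs T hT =>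
    (hβ.2 s hs).2.1 (le_refl (0:ℝ)) hT hT
  have hβn : ∀ s T, 0 ≤ s → 0 ≤ T → 0 ≤ β s T := fun s T hs hT => (hβ.1 T hT).2.2.2 s hs
  have hγr0 : ∀ M, r0 ≤ M → γ M ≤ M := by
    intro M hM
    apply le_of_forall_gt_imp_ge_of_dense
    intro r hr
    exact (hγmono M r (hr0.trans hM) hr.le).trans (hγr r (lt_of_le_of_lt hM hr)).le
  have hsup : ∀ τ u x y, (τ, u, x, y) ∈ S → ∀ t0 t : ℝ, t0 ∈ 𝒯 → t ∈ 𝒯 → 0 ≤ t0 → t0 ≤ t →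
      (t : EReal) < τ → 0 ≤ supT 𝒯 y t0 t ∧
      (∀ s, s ∈ 𝒯 → t0 ≤ s → s ≤ t → y s ≤ supT 𝒯 y t0 t) ∧
      (∀ B, (∀ s, s ∈ 𝒯 → t0 ≤ s → s ≤ t → y s ≤ B) → supT 𝒯 y t0 t ≤ B) := by
    intro τ u x y hmem t0 t ht0 ht h0 htt hτ
    obtain ⟨_, hnn, hb⟩ := hS τ u x y hmem
    have h1 : ∀ s, s ∈ 𝒯 → t0 ≤ s → s ≤ t → y s ≤ supT 𝒯 y t0 t := by
      intro s hs h1 h2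
      exact le_csSup (hb t0 t h0 htt hτ) ⟨s, ⟨hs, h1, h2⟩, rfl⟩
    refine ⟨(hnn t ht (h0.trans htt) hτ).2.trans (h1 t ht htt le_rfl), h1, ?_⟩
    intro B hB
    refine csSup_le ⟨y t, t, ⟨ht, htt, le_rfl⟩, rfl⟩ ?_
    rintro _ ⟨s, ⟨hs, h1, h2⟩, rfl⟩
    exact hB s hs h1 h2
  have hlt : ∀ (τ : EReal) (s t : ℝ), s ≤ t → (t : EReal) < τ → (s : EReal) < τ :=
    fun τ s t hst h => lt_of_le_of_lt (EReal.coe_le_coe_iff.2 hst) h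
  have hshort : ∀ τ u x y, (τ, u, x, y) ∈ S → ∀ t0 t : ℝ, t0 ∈ 𝒯 → t ∈ 𝒯 → 0 ≤ t0 → t0 ≤ t →
      (t : EReal) < τ → supT 𝒯 y t0 t ≤ max (max (β (x t0) 0) (μa u t0 t)) (max C r0) := by
    intro τ u x y hmem t0 t ht0 ht h0 htt hτ
    obtain ⟨_, hnn, hb⟩ := hS τ u x y hmem
    obtain ⟨s1, s2, s3⟩ := hsup τ u x y hmem t0 t ht0 ht h0 htt hτ
    by_contra hcon
    rw [not_le] at hcon
    have hx0 := (hnn t0 ht0 h0 (hlt τ t0 t htt hτ)).1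
    set Y := supT 𝒯 y t0 t with hY
    have hr : r0 < Y := lt_of_le_of_lt ((le_max_right _ _).trans (le_max_right _ _)) hcon
    have hlast : Y ≤ max (max (β (x t0) 0) (μa u t0 t)) (max C (γ Y)) := by
      apply s3
      intro s hs hs1 hs2
      have q1 := hH1 τ u x y hmem t0 s ht0 hs h0 hs1 (hlt τ s t hs2 hτ)
      obtain ⟨s1', _, s3'⟩ := hsup τ u x y hmem t0 s ht0 hs h0 hs1 (hlt τ s t hs2 hτ)
      have q2 : supT 𝒯 y t0 s ≤ Y := s3' _ (fun r hr h1 h2 => s2 r hr h1 (h2.trans hs2))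
      have q3 := hγmono _ _ s1' q2
      have q4 := hβanti (x t0) hx0 (s - t0) (by linarith)
      have q5 := hμa.2 u t0 t0 s t h0 le_rfl hs1 hs2
      refine q1.trans (max_le (max_le ?_ ?_) (max_le ?_ ?_))
      · exact q4.trans ((le_max_left _ _).trans (le_max_left _ _))
      · exact q3.trans ((le_max_right _ _).trans (le_max_right _ _))
      · exact q5.trans ((le_max_right _ _).trans (le_max_left _ _))
      · exact (le_max_left _ _).trans (le_max_right _ _)
    have hlt2 := hγr Y hr
    have w1 := (max_lt_iff.1 hcon).1
    have w2 := (max_lt_iff.1 (max_lt_iff.1 hcon).2).1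
    exact absurd hlast (not_le.2 (max_lt w1 (max_lt w2 hlt2)))
  set M : U → ℝ → ℝ → ℝ := fun u t0 t =>
    max (max (max (β (σ3 (μa u t0 t)) 0) (β (μb u t0 t) 0)) (μa u t0 t)) (max C r0) with hM
  have hMr : ∀ u t0 t, r0 ≤ M u t0 t := fun u t0 t => (le_max_right _ _).trans (le_max_right _ _)
  have hMmono : ∀ u t0 s t, 0 ≤ t0 → t0 ≤ s → s ≤ t → M u t0 s ≤ M u t0 t := by
    intro u t0 s t h0 h1 h2
    have q1 := hμa.2 u t0 t0 s t h0 le_rfl h1 h2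
    have q2 := hμb.2 u t0 t0 s t h0 le_rfl h1 h2
    have q3 := hμa.1 u t0 s h0 (h0.trans h1)
    have q4 := hμb.1 u t0 s h0 (h0.trans h1)
    have q5 := hβmono 0 le_rfl _ _ (hσ3n _ q3) (hσ3mono _ _ q3 q1)
    have q6 := hβmono 0 le_rfl _ _ q4 q2
    simp only [hM]
    gcongr
  set P : ℝ → ℝ → Prop := fun X a => ∃ T, T ∈ 𝒯 ∧ 0 ≤ T ∧ ∀ τ u x y, (τ, u, x, y) ∈ S →
    ∀ t0 t : ℝ, t0 ∈ 𝒯 → t ∈ 𝒯 → 0 ≤ t0 → t0 ≤ t → (t : EReal) < τ → x t0 ≤ X → t0 + T ≤ t →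
      y t ≤ max a (M u t0 t) with hP
  have hinit : ∀ X, P X (β X 0) := by
    intro X
    refine ⟨0, 𝒯.zero_mem, le_rfl, ?_⟩
    intro τ u x y hmem t0 t ht0 ht h0 htt hτ hX _
    have q1 := hshort τ u x y hmem t0 t ht0 ht h0 htt hτ
    have q2 := (hsup τ u x y hmem t0 t ht0 ht h0 htt hτ).2.1 t ht htt le_rfl
    have hx0 := ((hS τ u x y hmem).2.1 t0 ht0 h0 (hlt τ t0 t htt hτ)).1
    have q3 := hβmono 0 le_rfl _ _ hx0 hX
    refine q2.trans (q1.trans (max_le (max_le ?_ ?_) ?_))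
    · exact q3.trans (le_max_left _ _)
    · exact ((le_max_right _ _).trans (le_max_left _ _)).trans (le_max_right _ _)
    · exact (le_max_right _ _).trans (le_max_right _ _)
  have hstep : (∀ R : ℝ, ∃ T, T ∈ 𝒯 ∧ R ≤ T) → ∀ X, 0 ≤ X → ∀ a b, 0 ≤ a → γ a ≤ b → 0 < b →
      P X a → P X b := by
    intro hunb X hX a b ha hab hb ⟨T, hT, hT0, hPT⟩
    set K : ℝ := max (max (σ1 X) (σ2 T)) (max (max (σ3 (β X 0)) (max (σ3 C) (σ3 r0))) d) with hK
    have hK0 : 0 ≤ K := hd.trans ((le_max_right _ _).trans (le_max_right _ _))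
    have hev := (hβ.2 K hK0).2.2.eventually (gt_mem_nhds hb)
    obtain ⟨R, hR⟩ := eventually_atTop.1 hev
    obtain ⟨T1, hT1, hT1R⟩ := hunb (max R 0)
    refine ⟨T + T1, 𝒯.add_mem hT hT1, by linarith [le_max_right R 0], ?_⟩
    intro τ u x y hmem t0 t ht0 ht h0 htt hτ hxX htT
    have hT10 : 0 ≤ T1 := (le_max_right R 0).trans hT1R
    have ht1 : t0 + T ∈ 𝒯 := 𝒯.add_mem ht0 hT
    set t1 := t0 + T with ht1d
    have h01 : t0 ≤ t1 := by linarith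
    have h1t : t1 ≤ t := by linarith
    have h1τ := hlt τ t1 t h1t hτ
    have hx0 := ((hS τ u x y hmem).2.1 t0 ht0 h0 (hlt τ t0 t htt hτ)).1
    have hx1 := ((hS τ u x y hmem).2.1 t1 ht1 (h0.trans h01) h1τ).1
    have hna := hμa.1 u t0 t h0 (h0.trans htt)
    have hnb := hμb.1 u t0 t h0 (h0.trans htt)
    have q1 := hH2 τ u x y hmem t0 t1 ht0 ht1 h0 h01 h1τ
    have q2 := hshort τ u x y hmem t0 t1 ht0 ht1 h0 h01 h1τ
    have q3 := hμa.2 u t0 t0 t1 t h0 le_rfl h01 h1t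
    have q4 := hμb.2 u t0 t0 t1 t h0 le_rfl h01 h1t
    have q5 := hβmono 0 le_rfl _ _ hx0 hxX
    have q6 : supT 𝒯 y t0 t1 ≤ max (max (β X 0) (μa u t0 t)) (max C r0) :=
      q2.trans (max_le_max (max_le_max q5 q3) le_rfl)
    have hs0 := (hsup τ u x y hmem t0 t1 ht0 ht1 h0 h01 h1τ).1
    have q7 := hσ3mono _ _ hs0 q6
    have q8 : σ3 (max (max (β X 0) (μa u t0 t)) (max C r0)) ≤
        max (max (σ3 (β X 0)) (σ3 (μa u t0 t))) (max (σ3 C) (σ3 r0)) := by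
      rcases max_choice (max (β X 0) (μa u t0 t)) (max C r0) with h | h <;>
      rcases max_choice (β X 0) (μa u t0 t) with hv2 | hv2 <;>
      rcases max_choice C r0 with hv3 | hv3 <;> rw [h] <;> simp [hv2, hv3]
    have q9 := hσ1mono _ _ hx0 hxX
    have q10 : t1 - t0 = T := by simp [ht1d]
    rw [q10] at q1
    have q11 : x t1 ≤ max K (max (σ3 (μa u t0 t)) (μb u t0 t)) := by
      have k1 : σ1 X ≤ K := (le_max_left _ _).trans (le_max_left _ _)
      have k2 : σ2 T ≤ K := (le_max_right _ _).trans (le_max_left _ _)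
      have k3 : max (σ3 (β X 0)) (max (σ3 C) (σ3 r0)) ≤ K :=
        (le_max_left _ _).trans (le_max_right _ _)
      have k4 : d ≤ K := (le_max_right _ _).trans (le_max_right _ _)
      have k5 := le_max_left K (max (σ3 (μa u t0 t)) (μb u t0 t))
      have k6 := le_max_right K (max (σ3 (μa u t0 t)) (μb u t0 t))
      refine q1.trans (max_le (max_le ?_ ?_) (max_le ?_ (max_le ?_ ?_)))
      · exact (q9.trans k1).trans k5
      · exact k2.trans k5
      · refine (q7.trans q8).trans (max_le (max_le ?_ ?_) ?_)
        · exact ((le_max_left _ _).trans k3).trans k5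
        · exact (le_max_left _ _).trans k6
        · exact ((le_max_right _ _).trans k3).trans k5
      · exact q4.trans ((le_max_right _ _).trans k6)
      · exact k4.trans k5
    have hTn : 0 ≤ t - t1 := by linarith
    have q12 : β (x t1) (t - t1) ≤ max b (M u t0 t) := by
      refine (hβmono _ hTn _ _ hx1 q11).trans ?_
      have z1 := hR (t - t1) (by linarith [le_max_left R 0])
      have z2 := hβanti _ (hσ3n _ hna) _ hTn
      have z3 := hβanti _ hnb _ hTn
      simp only [hM]
      rcases max_choice K (max (σ3 (μa u t0 t)) (μb u t0 t)) with h | h <;> rw [h]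
      · exact z1.le.trans (le_max_left _ _)
      · rcases max_choice (σ3 (μa u t0 t)) (μb u t0 t) with h | h <;> rw [h]
        · refine z2.trans ?_
          simp
        · refine z3.trans ?_
          simp
    have p1 : supT 𝒯 y t1 t ≤ max a (M u t0 t) := by
      apply (hsup τ u x y hmem t1 t ht1 ht (h0.trans h01) h1t hτ).2.2
      intro s hs hs1 hs2
      refine (hPT τ u x y hmem t0 s ht0 hs h0 (h01.trans hs1) (hlt τ s t hs2 hτ) hxX hs1).trans ?_
      exact max_le_max le_rfl (hMmono u t0 s t h0 (h01.trans hs1) hs2)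
    have p2 := hγmono _ _ (hsup τ u x y hmem t1 t ht1 ht (h0.trans h01) h1t hτ).1 p1
    have p3 : γ (max a (M u t0 t)) ≤ max b (M u t0 t) := by
      rcases max_choice a (M u t0 t) with h | h <;> rw [h]
      · exact hab.trans (le_max_left _ _)
      · exact (hγr0 _ (hMr u t0 t)).trans (le_max_right _ _)
    have p4 := hμa.2 u t0 t1 t t h0 h01 h1t le_rfl
    have p5 : μa u t0 t ≤ M u t0 t := by simp [hM]
    have p6 : C ≤ M u t0 t := by simp [hM]
    have p7 := hH1 τ u x y hmem t1 t ht1 ht (h0.trans h01) h1t hτ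
    refine p7.trans (max_le (max_le q12 (p2.trans p3)) (max_le ?_ ?_))
    · exact (p4.trans p5).trans (le_max_right _ _)
    · exact p6.trans (le_max_right _ _)
  have hPmono : ∀ X a b, a ≤ b → P X a → P X b := by
    intro X a b hab ⟨T, hT, hT0, hPT⟩
    exact ⟨T, hT, hT0, fun τ u x y hmem t0 t ht0 ht h0 htt hτ hX h =>
      (hPT τ u x y hmem t0 t ht0 ht h0 htt hτ hX h).trans (max_le_max hab le_rfl)⟩
  have hfin : ∀ X, 0 ≤ X → ∀ ε, 0 < ε → ∃ T, ∀ τ u x y, (τ, u, x, y) ∈ S →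
      ∀ t0 t : ℝ, t0 ∈ 𝒯 → t ∈ 𝒯 → 0 ≤ t0 → t0 ≤ t → (t : EReal) < τ → x t0 ≤ X → t0 + T ≤ t →
      y t ≤ max (r0 + ε) (M u t0 t) := by
    intro X hX ε hε
    by_cases hpos : ∃ p, p ∈ 𝒯 ∧ 0 < p
    · obtain ⟨p, hp, hp0⟩ := hpos
      have hunb : ∀ R : ℝ, ∃ T, T ∈ 𝒯 ∧ R ≤ T := by
        intro R
        obtain ⟨n, hn⟩ := Archimedean.arch R hp0
        exact ⟨n • p, 𝒯.nsmul_mem hp n, hn⟩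
      set A : Set ℝ := {a | 0 ≤ a ∧ P X a} with hA
      have hAne : A.Nonempty := ⟨β X 0, hβn X 0 hX le_rfl, hinit X⟩
      have hAb : BddBelow A := ⟨0, fun a ha => ha.1⟩
      have hinf : sInf A ≤ r0 := by
        by_contra hcon
        rw [not_le] at hcon
        set z := sInf A with hz
        have hz0 : 0 < z := lt_of_le_of_lt hr0 hcon
        have h1 := hγr z hcon
        have h2 := hγn z hz0.le
        have hca : ContinuousAt γ z := hγc.continuousAt (Ici_mem_nhds hz0)
        have hev := hca.eventually (gt_mem_nhds (show γ z < (γ z + z) / 2 by linarith))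
        obtain ⟨δ, hδ, hb⟩ := Metric.eventually_nhds_iff.1 hev
        obtain ⟨a, haA, ha⟩ := exists_lt_of_csInf_lt hAne (show sInf A < z + δ by linarith)
        have haz : z ≤ a := csInf_le hAb haA
        have h3 := hb (show dist a z < δ by
          rw [Real.dist_eq, abs_of_nonneg (by linarith)]; linarith)
        have h4 := hstep hunb X hX a ((γ z + z) / 2) haA.1 h3.le (by linarith) haA.2
        have h5 : z ≤ (γ z + z) / 2 := csInf_le hAb ⟨by linarith, h4⟩
        linarith
      obtain ⟨a, haA, ha⟩ := exists_lt_of_csInf_lt hAne (show sInf A < r0 + ε by linarith)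
      obtain ⟨T, _, _, h⟩ := hPmono X a (r0 + ε) ha.le haA.2
      exact ⟨T, h⟩
    · refine ⟨1, ?_⟩
      intro τ u x y hmem t0 t ht0 ht h0 htt hτ hX h
      exact absurd ⟨t - t0, 𝒯.sub_mem ht ht0, by linarith⟩ hpos
  set M2 : U → ℝ → ℝ → ℝ := fun u t0 t =>
    max (max (max (β (σ3 (μa u t0 t)) 0) (β (μb u t0 t) 0)) (μa u t0 t))
      (max (3 * C) (3 * r0)) with hM2
  have hMM2 : ∀ u t0 t, M u t0 t ≤ M2 u t0 t := by
    intro u t0 t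
    simp only [hM, hM2]
    exact max_le_max le_rfl (max_le_max (by linarith) (by linarith))
  have hM2r : ∀ u t0 t, 3 * r0 ≤ M2 u t0 t := fun u t0 t =>
    (le_max_right _ _).trans (le_max_right _ _)
  set Q : ℝ → ℝ → Set ℝ := fun s T => insert 0 {v | ∃ τ u x y, (τ, u, x, y) ∈ S ∧
    ∃ t0 t : ℝ, t0 ∈ 𝒯 ∧ t ∈ 𝒯 ∧ 0 ≤ t0 ∧ t0 ≤ t ∧ (t : EReal) < τ ∧ x t0 ≤ s ∧ T ≤ t - t0 ∧
      M2 u t0 t < y t ∧ v = y t} with hQ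
  have hQle : ∀ s T, 0 ≤ s → ∀ v ∈ Q s T, v ≤ β s 0 := by
    intro s T hs v hv
    rcases hv with rfl | ⟨τ, u, x, y, hmem, t0, t, ht0, ht, h0, htt, hτ, hX, hT, hlt', rfl⟩
    · exact hβn s 0 hs le_rfl
    · obtain ⟨T, hT, hT0, h⟩ := hinit s
      have q1 := hshort τ u x y hmem t0 t ht0 ht h0 htt hτ
      have q2 := (hsup τ u x y hmem t0 t ht0 ht h0 htt hτ).2.1 t ht htt le_rfl
      have hx0 := ((hS τ u x y hmem).2.1 t0 ht0 h0 (hlt τ t0 t htt hτ)).1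
      have q3 := hβmono 0 le_rfl _ _ hx0 hX
      have q4 := lt_of_le_of_lt (hMM2 u t0 t) hlt'
      obtain ⟨q5, q6⟩ := max_lt_iff.1 q4
      rcases le_max_iff.1 (q2.trans q1) with q7 | q7
      · rcases le_max_iff.1 q7 with q7 | q7
        · exact q7.trans q3
        · exact absurd q7 (not_le.2 (max_lt_iff.1 q5).2)
      · exact absurd q7 (not_le.2 q6)
  have hQneg : ∀ s T, s < 0 → ∀ v ∈ Q s T, v = 0 := by
    intro s T hs v hv
    rcases hv with rfl | ⟨τ, u, x, y, hmem, t0, t, ht0, ht, h0, htt, hτ, hX, hT, hlt', rfl⟩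
    · rfl
    · have hx0 := ((hS τ u x y hmem).2.1 t0 ht0 h0 (hlt τ t0 t htt hτ)).1
      linarith
  have hQb : ∀ s T, BddAbove (Q s T) := by
    intro s T
    rcases le_or_gt 0 s with hs | hs
    · exact ⟨β s 0, fun v hv => hQle s T hs v hv⟩
    · exact ⟨0, fun v hv => (hQneg s T hs v hv).le⟩
  have hQ0 : ∀ s T, (0:ℝ) ∈ Q s T := fun s T => mem_insert _ _
  have hg0 : ∀ s T, 0 ≤ sSup (Q s T) := fun s T => le_csSup (hQb s T) (hQ0 s T)
  obtain ⟨βt, hβt, hle⟩ := SG_KL_majorant (fun s T => sSup (Q s T)) (fun s => β s 0)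
    (hβ.1 0 le_rfl) hg0
    (by
      intro s s' T T' hs hT
      refine csSup_le_csSup (hQb _ _) ⟨0, hQ0 s T⟩ ?_
      rintro v (rfl | ⟨τ, u, x, y, hmem, t0, t, ht0, ht, h0, htt, hτ, hX, hT2, hlt', rfl⟩)
      · exact hQ0 _ _
      · exact Or.inr ⟨τ, u, x, y, hmem, t0, t, ht0, ht, h0, htt, hτ, hX.trans hs, hT.trans hT2,
          hlt', rfl⟩)
    (fun s T hs => csSup_le ⟨0, hQ0 s T⟩ (hQle s T hs))
    (by
      intro s hs
      rw [Metric.tendsto_atTop]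
      intro ε hε
      obtain ⟨T, hT⟩ := hfin s hs (ε / 4) (by linarith)
      refine ⟨T, fun T' hT' => ?_⟩
      rw [Real.dist_eq, sub_zero, abs_of_nonneg (hg0 s T')]
      refine lt_of_le_of_lt (csSup_le ⟨0, hQ0 s T'⟩ ?_) (show ε / 2 < ε by linarith)
      rintro v (rfl | ⟨τ, u, x, y, hmem, t0, t, ht0, ht, h0, htt, hτ, hX, hT2, hlt', rfl⟩)
      · linarith
      · have q1 := hT τ u x y hmem t0 t ht0 ht h0 htt hτ hX (by linarith)
        have q2 := hMM2 u t0 t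
        have q3 := hM2r u t0 t
        rcases le_max_iff.1 q1 with q1 | q1 <;> linarith)
  refine ⟨βt, hβt, ?_⟩
  intro τ u x y hmem t0 t ht0 ht h0 htt hτ
  have hx0 := ((hS τ u x y hmem).2.1 t0 ht0 h0 (hlt τ t0 t htt hτ)).1
  rcases le_or_gt (y t) (M2 u t0 t) with h | h
  · refine h.trans ?_
    simp only [hM2]
    exact max_le_max (le_max_right _ _) le_rfl
  · have q1 := hle (x t0) (t - t0) hx0
    have q2 : y t ≤ sSup (Q (x t0) (t - t0)) := le_csSup (hQb _ _) (Or.inr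
      ⟨τ, u, x, y, hmem, t0, t, ht0, ht, h0, htt, hτ, le_rfl, le_rfl, h, rfl⟩)
    exact (q2.trans q1).trans ((le_max_left _ _).trans (le_max_left _ _))

/-- **Small-gain theorem, additive form** (Corollary 3.3).  Here `ρ⁻¹` is the inverse
of the class-𝒦∞ function `ρ` on `[0,∞)`, `α(s) = max {4ρ⁻¹(3s), 4s}`, and
`μᵐ(u,a,b) = max {α(β(σ₃(α(μᵃ(u,a,b))),0)), α(β(μᵇ(u,a,b),0)), α(μᵃ(u,a,b))}`. -/
theorem small_gain_additive {U : Type*} (𝒯 : AddSubgroup ℝ)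
    (μa μb : U → ℝ → ℝ → ℝ) (hμa : InputMeasure μa) (hμb : InputMeasure μb)
    (β : ℝ → ℝ → ℝ) (hβ : ClassKL β)
    (r0 : ℝ) (hr0 : 0 ≤ r0)
    (γ : ℝ → ℝ) (hγ : ClassK γ)
    (ρ : ℝ → ℝ) (hρ : ClassKInf ρ)
    (ρinv : ℝ → ℝ) (hρinv : ∀ s, 0 ≤ s → 0 ≤ ρinv s ∧ ρ (ρinv s) = s)
    (hρinv' : ∀ s, 0 ≤ s → ρinv (ρ s) = s)
    (hγρ : ∀ r, r0 < r → γ r + ρ (γ r) < r)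
    (σ1 σ2 σ3 : ℝ → ℝ) (hσ1 : ClassK σ1) (hσ2 : ClassK σ2) (hσ3 : ClassK σ3)
    (d : ℝ) (hd : 0 ≤ d) (C : ℝ) (hC : 0 ≤ C)
    (α : ℝ → ℝ) (hα : ∀ s, α s = max (4 * ρinv (3 * s)) (4 * s))
    (S : Set (EReal × U × (ℝ → ℝ) × (ℝ → ℝ)))
    (hS : ∀ τ u x y, (τ, u, x, y) ∈ S → IsTraj 𝒯 τ x y)
    (hH1' : ∀ τ u x y, (τ, u, x, y) ∈ S → H1' 𝒯 μa β γ C τ u x y)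
    (hH2 : ∀ τ u x y, (τ, u, x, y) ∈ S → H2 𝒯 μb σ1 σ2 σ3 d τ u x y) :
    ∃ βt : ℝ → ℝ → ℝ, ClassKL βt ∧
      ∀ τ u x y, (τ, u, x, y) ∈ S →
        ∀ t0 t : ℝ, t0 ∈ 𝒯 → t ∈ 𝒯 → 0 ≤ t0 → t0 ≤ t → (t : EReal) < τ →
          y t ≤ max (max (βt (x t0) (t - t0))
              (max (max (α (β (σ3 (α (μa u t0 t))) 0)) (α (β (μb u t0 t) 0)))
                (α (μa u t0 t))))
            (max (3 * α C) (3 * r0)) := by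
  obtain ⟨⟨hρc, hρm, hρ0, hρn⟩, hρt⟩ := hρ
  have hi0 : ρinv 0 = 0 := by
    have := hρinv' 0 le_rfl
    rwa [hρ0] at this
  have hρmono : ∀ a b, 0 ≤ a → a ≤ b → ρ a ≤ ρ b := fun a b ha hab =>
    hρm.monotoneOn ha (ha.trans hab : (0:ℝ) ≤ b) hab
  have hism : StrictMonoOn ρinv (Ici 0) := by
    intro a ha b hb hab
    by_contra hcon
    rw [not_lt] at hcon
    have := hρmono _ _ (hρinv b hb).1 hcon
    rw [(hρinv a ha).2, (hρinv b hb).2] at this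
    linarith
  have hic : ContinuousOn ρinv (Ici 0) := by
    intro s hs
    have hs' : (0:ℝ) ≤ s := hs
    rw [Metric.continuousWithinAt_iff]
    intro ε hε
    have hz := hρinv s hs'
    have hu : s < ρ (ρinv s + ε / 2) := by
      have := hρm (show (0:ℝ) ≤ ρinv s from hz.1) (show (0:ℝ) ≤ ρinv s + ε / 2 by linarith)
        (by linarith)
      rwa [hz.2] at this
    have hl : ∃ δ > 0, ∀ v, 0 ≤ v → s - δ < v → ρinv s - ε < ρinv v := by
      by_cases hc : 0 ≤ ρinv s - ε / 2
      · have hl : ρ (ρinv s - ε / 2) < s := by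
          have := hρm (show (0:ℝ) ≤ ρinv s - ε / 2 from hc) (show (0:ℝ) ≤ ρinv s from hz.1)
            (by linarith)
          rwa [hz.2] at this
        refine ⟨s - ρ (ρinv s - ε / 2), by linarith, ?_⟩
        intro v hv hv2
        have := hism.monotoneOn (show ρ (ρinv s - ε / 2) ∈ Ici (0:ℝ) from hρn _ hc)
          (show v ∈ Ici (0:ℝ) from hv) (by linarith)
        rw [hρinv' _ hc] at this
        linarith
      · refine ⟨1, one_pos, fun v hv _ => ?_⟩
        have := (hρinv v hv).1
        linarith
    obtain ⟨δ, hδ, hl⟩ := hl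
    refine ⟨min δ (ρ (ρinv s + ε / 2) - s), lt_min hδ (by linarith), ?_⟩
    intro v hv hd'
    have hv' : (0:ℝ) ≤ v := hv
    rw [Real.dist_eq] at hd' ⊢
    have d1 := abs_lt.1 (lt_of_lt_of_le hd' (min_le_left _ _))
    have d2 := abs_lt.1 (lt_of_lt_of_le hd' (min_le_right _ _))
    have e1 := hl v hv' (by linarith)
    have e2 := hism.monotoneOn hv (show ρ (ρinv s + ε / 2) ∈ Ici (0:ℝ) from
      hρn _ (by linarith)) (by linarith)
    rw [hρinv' _ (by linarith)] at e2
    rw [abs_lt]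
    constructor <;> linarith
  have hαK : ClassK α := by
    have hαe : α = fun s => max (4 * ρinv (3 * s)) (4 * s) := funext hα
    refine ⟨?_, ?_, ?_, ?_⟩
    · rw [hαe]
      refine ContinuousOn.sup (continuousOn_const.mul (hic.comp (by fun_prop) ?_)) (by fun_prop)
      intro s hs
      have hs' : (0:ℝ) ≤ s := hs
      show (0:ℝ) ≤ 3 * s
      linarith
    · intro a ha b hb hab
      have ha' : (0:ℝ) ≤ a := ha
      have := hism (show (0:ℝ) ≤ 3 * a by linarith) (show (0:ℝ) ≤ 3 * b by linarith) (by linarith)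
      rw [hα, hα]
      exact max_lt_max (by linarith) (by linarith)
    · rw [hα]; simp [hi0]
    · intro s hs
      rw [hα]
      exact le_max_of_le_right (by linarith)
  have hαmono : ∀ a b, 0 ≤ a → a ≤ b → α a ≤ α b := fun a b ha hab =>
    hαK.2.1.monotoneOn ha (ha.trans hab : (0:ℝ) ≤ b) hab
  have hαn := hαK.2.2.2
  have hcomp : ∀ f g, ClassK f → ClassK g → ClassK (fun s => f (g s)) := by
    intro f g hf hg
    refine ⟨hf.1.comp hg.1 (fun s hs => hg.2.2.2 s hs), ?_, ?_, ?_⟩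
    · intro a ha b hb hab
      exact hf.2.1 (hg.2.2.2 a ha) (hg.2.2.2 b hb) (hg.2.1 ha hb hab)
    · simp [hg.2.2.1, hf.2.2.1]
    · intro s hs
      exact hf.2.2.2 _ (hg.2.2.2 s hs)
  have hβ' : ClassKL (fun s T => α (β s T)) := by
    refine ⟨fun T hT => hcomp α _ hαK (hβ.1 T hT), ?_⟩
    intro s hs
    have hn : ∀ T, 0 ≤ T → 0 ≤ β s T := fun T hT => (hβ.1 T hT).2.2.2 s hs
    refine ⟨hαK.1.comp (hβ.2 s hs).1 (fun T hT => hn T hT), ?_, ?_⟩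
    · intro a ha b hb hab
      exact hαmono _ _ (hn b hb) ((hβ.2 s hs).2.1 ha hb hab)
    · have hc := hαK.1 0 (le_refl (0:ℝ))
      have h1 : Tendsto (β s) atTop (nhdsWithin 0 (Ici 0)) := by
        refine tendsto_nhdsWithin_iff.2 ⟨(hβ.2 s hs).2.2, ?_⟩
        filter_upwards [eventually_ge_atTop 0] with T hT using hn T hT
      have h2 := hc.tendsto.comp h1
      rw [hαK.2.2.1] at h2
      exact h2
  have hρK : ClassK ρ := ⟨hρc, hρm, hρ0, hρn⟩
  have hγ' : ClassK (fun r => γ r + ρ (γ r)) := by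
    have h := hcomp ρ γ hρK hγ
    refine ⟨hγ.1.add h.1, hγ.2.1.add h.2.1, ?_, ?_⟩
    · have := h.2.2.1
      simp only at this
      simp [hγ.2.2.1, hρ0]
    · intro s hs
      exact add_nonneg (hγ.2.2.2 s hs) (h.2.2.2 s hs)
  have hμa2 : InputMeasure (fun u a b => α (max (μa u a b) 0)) := by
    refine ⟨fun u a b ha hb => hαn _ (le_max_right _ _), ?_⟩
    intro u a b c d h1 h2 h3 h4
    exact hαmono _ _ (le_max_right _ _) (max_le_max (hμa.2 u a b c d h1 h2 h3 h4) le_rfl)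
  have hpos : ∀ u a b, 0 ≤ a → a ≤ b → max (μa u a b) 0 = μa u a b := fun u a b ha hb =>
    max_eq_left (hμa.1 u a b ha (ha.trans hb))
  obtain ⟨βt, hβt, h⟩ := SG_max 𝒯 (fun u a b => α (max (μa u a b) 0)) μb hμa2 hμb
    (fun s T => α (β s T)) hβ' r0 hr0 (fun r => γ r + ρ (γ r)) hγ' hγρ σ1 σ2 σ3 hσ1 hσ3 d hd
    (α C) (hαn C hC) S hS
    (by
      intro τ u x y hmem t0 t ht0 ht h0 htt hτ
      have q := hH1' τ u x y hmem t0 t ht0 ht h0 htt hτ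
      obtain ⟨_, hnn, hb⟩ := hS τ u x y hmem
      have hx0 := (hnn t0 ht0 h0 (lt_of_le_of_lt (EReal.coe_le_coe_iff.2 htt) hτ)).1
      have hY : 0 ≤ supT 𝒯 y t0 t := (hnn t ht (h0.trans htt) hτ).2.trans
        (le_csSup (hb t0 t h0 htt hτ) ⟨t, ⟨ht, htt, le_rfl⟩, rfl⟩)
      have hG := hγ.2.2.2 _ hY
      have hB := (hβ.1 (t - t0) (by linarith)).2.2.2 _ hx0
      simp only at hB
      have hA := hμa.1 u t0 t h0 (h0.trans htt)
      simp only [hpos u t0 t h0 htt]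
      set G := γ (supT 𝒯 y t0 t)
      set B := β (x t0) (t - t0)
      set A := μa u t0 t
      have hmain : ∀ m, 0 ≤ m → B ≤ m → A ≤ m → C ≤ m → y t ≤ max (G + ρ G) (α m) := by
        intro m hm h1 h2 h3
        rcases le_total (3 * m) (ρ G) with hc | hc
        · exact le_max_of_le_left (by linarith)
        · apply le_max_of_le_right
          have e := hism.monotoneOn (show ρ G ∈ Ici (0:ℝ) from hρn _ hG)
            (show (0:ℝ) ≤ 3 * m by linarith) hc
          rw [hρinv' _ hG] at e
          rw [hα]
          have l1 := le_max_left (4 * ρinv (3 * m)) (4 * m)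
          have l2 := le_max_right (4 * ρinv (3 * m)) (4 * m)
          linarith
      have hm1 : B ≤ max B (max A C) := le_max_left _ _
      have hm2 : A ≤ max B (max A C) := (le_max_left _ _).trans (le_max_right _ _)
      have hm3 : C ≤ max B (max A C) := (le_max_right _ _).trans (le_max_right _ _)
      refine (hmain _ (hC.trans hm3) hm1 hm2 hm3).trans (max_le ?_ ?_)
      · exact (le_max_right _ _).trans (le_max_left _ _)
      · rcases max_choice B (max A C) with h | h <;> rw [h]
        · exact (le_max_left _ _).trans (le_max_left _ _)
        · rcases max_choice A C with h | h <;> rw [h]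
          · exact (le_max_left _ _).trans (le_max_right _ _)
          · exact (le_max_right _ _).trans (le_max_right _ _))
    hH2
  refine ⟨βt, hβt, ?_⟩
  intro τ u x y hmem t0 t ht0 ht h0 htt hτ
  have q := h τ u x y hmem t0 t ht0 ht h0 htt hτ
  simp only [hpos u t0 t h0 htt] at q
  exact q
end

section
/- Small-gain theorem for input/output operators. Let U₁, U₂, Y₁, Y₂ be normed linear spaces and let F₁ : L∞₀(U₁×Y₂) → L∞₀(Y₁) and F₂ : L∞₀(U₂×Y₁) → L∞₀(Y₂) be input/output operators. Suppose there are class-𝒦𝓛 functions β₁, β₂ and class-𝒦 functions γ₁ᵘ, γ₁ʸ, γ₂ᵘ, γ₂ʸ such that |F₁(u₁,y₂)(t)| ≤ max{β₁(‖(u₁,y₂)‖_{(−∞,0]}, t), γ₁ᵘ(‖u₁‖_{[0,t]}), γ₁ʸ(‖y₂‖_{[0,t]})} and |F₂(u₂,y₁)(t)| ≤ max{β₂(‖(u₂,y₁)‖_{(−∞,0]}, t), γ₂ᵘ(‖u₂‖_{[0,t]}), γ₂ʸ(‖y₁‖_{[0,t]})} for all u₁ ∈ L∞₀(U₁), u₂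 ∈ L∞₀(U₂), y₁ ∈ L∞₀(Y₁), y₂ ∈ L∞₀(Y₂), and almost every t ≥ 0. If either γ₁ʸ(γ₂ʸ(s)) < s for all s > 0, or γ₂ʸ(γ₁ʸ(s)) < s for all s > 0, then there exist a class-𝒦𝓛 function β and a class-𝒦 function γ such that for any u₁ ∈ L∞₀(U₁), u₂ ∈ L∞₀(U₂) and any y₁ ∈ L∞₀(Y₁), y₂ ∈ L∞₀(Y₂) satisfying y₁(t) = F₁(u₁,y₂)(t) and y₂(t) = F₂(u₂,y₁)(t) for almost every t ∈ ℝ, one has max{|y₁(t)|, |y₂(t)|} ≤ max{β(‖(u₁,u₂)‖_{(−∞,0]}, t), γ(‖(u₁,u₂)‖_{[0,t]})} for almost every t ≥ 0. -/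
open Set Filter

open MeasureTheory

/-- `w ∈ L∞₀(S)`: `w : ℝ → S` is measurable, locally essentially bounded, and
vanishes before some time `t₀`. -/
def MemL0inf {S : Type*} [NormedAddCommGroup S] (w : ℝ → S) : Prop :=
  AEStronglyMeasurable w volume ∧
  (∀ a b : ℝ, ∃ M : ℝ, ∀ᵐ t ∂(volume.restrict (Icc a b)), ‖w t‖ ≤ M) ∧
  ∃ t0 : ℝ, ∀ t, t < t0 → w t = 0

/-- `‖w‖_I`: the essential supremum of `‖w(t)‖` over `t ∈ I`. -/
noncomputable def essSupI {S : Type*} [NormedAddCommGroup S] (w : ℝ → S)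
    (I : Set ℝ) : ℝ :=
  essSup (fun t => ‖w t‖) (volume.restrict I)

/-- `F` is causal: inputs agreeing a.e. up to time `T` produce outputs agreeing
a.e. up to time `T`. -/
def Causal {W Y : Type*} [NormedAddCommGroup W] [NormedAddCommGroup Y]
    (F : (ℝ → W) → ℝ → Y) : Prop :=
  ∀ v w : ℝ → W, MemL0inf v → MemL0inf w → ∀ T : ℝ,
    (∀ᵐ t ∂(volume.restrict (Iic T)), v t = w t) →
    (∀ᵐ t ∂(volume.restrict (Iic T)), F v t = F w t)

/-- `F` is shift invariant: `F (σ_c w) = σ_c (F w)` where `(σ_c w)(s) = w(s − c)`. -/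
def ShiftInvariant {W Y : Type*} [NormedAddCommGroup W] [NormedAddCommGroup Y]
    (F : (ℝ → W) → ℝ → Y) : Prop :=
  ∀ w : ℝ → W, MemL0inf w → ∀ c : ℝ,
    F (fun s => w (s - c)) = fun s => F w (s - c)


/-! ### Class K basics -/

theorem ClassK.mono {g : ℝ → ℝ} (h : ClassK g) {a b : ℝ} (ha : 0 ≤ a) (hab : a ≤ b) :
    g a ≤ g b :=
  h.2.1.monotoneOn ha (ha.trans hab) hab

theorem ClassK.nonneg {g : ℝ → ℝ} (h : ClassK g) {a : ℝ} (ha : 0 ≤ a) : 0 ≤ g a :=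
  h.2.2.2 a ha

theorem ClassK.map_max {g : ℝ → ℝ} (h : ClassK g) {a b : ℝ} (ha : 0 ≤ a) (hb : 0 ≤ b) :
    g (max a b) = max (g a) (g b) := by
  rcases le_total a b with hab | hab
  · rw [max_eq_right hab, max_eq_right (h.mono ha hab)]
  · rw [max_eq_left hab, max_eq_left (h.mono hb hab)]

theorem ClassK.id : ClassK (fun s => s) :=
  ⟨continuousOn_id, fun _ _ _ _ h => h, rfl, fun _ h => h⟩

theorem ClassK.comp {f g : ℝ → ℝ} (hf : ClassK f) (hg : ClassK g) :
    ClassK (fun s => f (g s)) :=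
  ⟨hf.1.comp hg.1 (fun s hs => hg.nonneg hs),
   fun a ha b hb hab => hf.2.1 (hg.nonneg ha) (hg.nonneg hb) (hg.2.1 ha hb hab),
   by simp [hg.2.2.1, hf.2.2.1],
   fun s hs => hf.nonneg (hg.nonneg hs)⟩

theorem ClassK.max {f g : ℝ → ℝ} (hf : ClassK f) (hg : ClassK g) :
    ClassK (fun s => max (f s) (g s)) :=
  ⟨ContinuousOn.sup hf.1 hg.1,
   fun a ha b hb hab => max_lt_max (hf.2.1 ha hb hab) (hg.2.1 ha hb hab),
   by simp [hg.2.2.1, hf.2.2.1],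
   fun s hs => le_max_of_le_left (hf.nonneg hs)⟩

theorem ClassK.iterate {f : ℝ → ℝ} (hf : ClassK f) (n : ℕ) : ClassK (fun s => f^[n] s) := by
  induction n with
  | zero => exact ClassK.id
  | succ n ih =>
    simp only [Function.iterate_succ_apply']
    exact hf.comp ih

theorem ClassK.le_of_lt {f : ℝ → ℝ} (hf : ClassK f) (h : ∀ s, 0 < s → f s < s) {s : ℝ}
    (hs : 0 ≤ s) : f s ≤ s := by
  rcases hs.eq_or_lt with rfl | hs
  · exact hf.2.2.1.le
  · exact (h s hs).le

theorem ClassK.iterate_antitone {f : ℝ → ℝ} (hf : ClassK f) (h : ∀ s, 0 < s → f s < s) {s : ℝ}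
    (hs : 0 ≤ s) : Antitone (fun n => f^[n] s) := by
  apply antitone_nat_of_succ_le
  intro n
  simp only [Function.iterate_succ_apply']
  exact hf.le_of_lt h ((hf.iterate n).nonneg hs)

theorem ClassK.iterate_tendsto {f : ℝ → ℝ} (hf : ClassK f) (h : ∀ s, 0 < s → f s < s) {s : ℝ}
    (hs : 0 ≤ s) : Tendsto (fun n => f^[n] s) atTop (nhds 0) := by
  have hb : BddBelow (range (fun n => f^[n] s)) :=
    ⟨0, by rintro _ ⟨n, rfl⟩; exact (hf.iterate n).nonneg hs⟩
  have ht := tendsto_atTop_ciInf (hf.iterate_antitone h hs) hb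
  set L := ⨅ n, f^[n] s with hL
  have hL0 : 0 ≤ L := le_ciInf (fun n => (hf.iterate n).nonneg hs)
  have h1 : Tendsto (fun n => f^[n+1] s) atTop (nhds L) :=
    (tendsto_add_atTop_iff_nat (f := fun n => f^[n] s) 1).2 ht
  have h2 : Tendsto (fun n => f (f^[n] s)) atTop (nhds (f L)) := by
    have hc : ContinuousWithinAt f (Ici 0) L := hf.1 L hL0
    exact hc.tendsto.comp (tendsto_nhdsWithin_iff.2
      ⟨ht, Eventually.of_forall (fun n => (hf.iterate n).nonneg hs)⟩)
  simp only [← Function.iterate_succ_apply' f] at h2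
  have he : L = f L := tendsto_nhds_unique h1 h2
  have : L = 0 := by
    rcases hL0.eq_or_lt with h0 | h0
    · exact h0.symm
    · exact absurd he.symm (h L h0).ne
  rwa [this] at ht

theorem ClassK.tendsto_zero {g : ℝ → ℝ} (hg : ClassK g) {ι : Type*} {l : Filter ι} {x : ι → ℝ}
    (hx : Tendsto x l (nhds 0)) (h0 : ∀ i, 0 ≤ x i) : Tendsto (fun i => g (x i)) l (nhds 0) := by
  have hc : ContinuousWithinAt g (Ici 0) 0 := hg.1 0 self_mem_Ici
  have := hc.tendsto
  rw [hg.2.2.1] at this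
  exact this.comp (tendsto_nhdsWithin_iff.2 ⟨hx, Eventually.of_forall h0⟩)

theorem ClassKL.nonneg {b : ℝ → ℝ → ℝ} (h : ClassKL b) {s t : ℝ} (hs : 0 ≤ s) (ht : 0 ≤ t) :
    0 ≤ b s t := (h.1 t ht).nonneg hs

/-! ### Essential suprema -/

theorem essSupI_eq {S : Type*} [NormedAddCommGroup S] (w : ℝ → S) (I : Set ℝ) :
    essSupI w I = sInf {a | ∀ᵐ t ∂(volume.restrict I), ‖w t‖ ≤ a} := by
  unfold essSupI
  rw [essSup_eq_sInf]
  congr 1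
  ext a
  simp only [mem_ofPred_eq, ae_iff, not_le]

theorem essSupI_le {S : Type*} [NormedAddCommGroup S] {w : ℝ → S} {I : Set ℝ} {M : ℝ}
    (hM : 0 ≤ M) (h : ∀ᵐ t ∂(volume.restrict I), ‖w t‖ ≤ M) : essSupI w I ≤ M := by
  rw [essSupI_eq]
  by_cases hI : (volume.restrict I) = 0
  · simp [hI, hM]
  · have : NeZero (volume.restrict I) := ⟨hI⟩
    refine csInf_le ⟨0, ?_⟩ h
    intro a ha
    have ha' : ∀ᵐ t ∂(volume.restrict I), ‖w t‖ ≤ a := ha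
    obtain ⟨t, ht⟩ := ha'.exists
    exact (norm_nonneg _).trans ht

theorem essSupI_nonneg {S : Type*} [NormedAddCommGroup S] (w : ℝ → S) (I : Set ℝ) :
    0 ≤ essSupI w I := by
  rw [essSupI_eq]
  by_cases hI : (volume.restrict I) = 0
  · simp [hI]
  · have : NeZero (volume.restrict I) := ⟨hI⟩
    apply Real.sInf_nonneg
    intro a ha
    have ha' : ∀ᵐ t ∂(volume.restrict I), ‖w t‖ ≤ a := ha
    obtain ⟨t, ht⟩ := ha'.exists
    exact (norm_nonneg _).trans ht

theorem ae_le_essSupI {S : Type*} [NormedAddCommGroup S] {w : ℝ → S} {I : Set ℝ} {M : ℝ}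
    (h : ∀ᵐ t ∂(volume.restrict I), ‖w t‖ ≤ M) :
    ∀ᵐ t ∂(volume.restrict I), ‖w t‖ ≤ essSupI w I :=
  ae_le_essSup ⟨M, h⟩

theorem MemL0inf.bdd {S : Type*} [NormedAddCommGroup S] {w : ℝ → S} (h : MemL0inf w) (b : ℝ) :
    ∃ M : ℝ, 0 ≤ M ∧ ∀ᵐ t ∂(volume : Measure ℝ), t ≤ b → ‖w t‖ ≤ M := by
  obtain ⟨-, h2, t0, h3⟩ := h
  obtain ⟨M, hM⟩ := h2 t0 b
  rw [ae_restrict_iff' measurableSet_Icc] at hM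
  refine ⟨max 0 M, le_max_left _ _, ?_⟩
  filter_upwards [hM] with t ht htb
  by_cases h0 : t < t0
  · simp [h3 t h0]
  · exact (ht ⟨not_lt.1 h0, htb⟩).trans (le_max_right _ _)

theorem MemL0inf.shift {S : Type*} [NormedAddCommGroup S] {w : ℝ → S} (h : MemL0inf w) (c : ℝ) :
    MemL0inf (fun t => w (t + c)) := by
  obtain ⟨h1, h2, t0, h3⟩ := h
  refine ⟨h1.comp_quasiMeasurePreserving
    (measurePreserving_add_right volume c).quasiMeasurePreserving, ?_, t0 - c, ?_⟩
  · intro a b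
    obtain ⟨M, hM⟩ := h2 (a + c) (b + c)
    refine ⟨M, ?_⟩
    rw [ae_restrict_iff' measurableSet_Icc] at hM ⊢
    have := (measurePreserving_add_right volume c).quasiMeasurePreserving.ae hM
    filter_upwards [this] with t ht htab
    exact ht ⟨by linarith [htab.1], by linarith [htab.2]⟩
  · intro t ht
    exact h3 _ (by linarith)

theorem MemL0inf.prodMk {S T : Type*} [NormedAddCommGroup S] [NormedAddCommGroup T]
    {w : ℝ → S} {z : ℝ → T} (h : MemL0inf w) (h' : MemL0inf z) :
    MemL0inf (fun t => (w t, z t)) := by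
  obtain ⟨h1, h2, t0, h3⟩ := h
  obtain ⟨h1', h2', t0', h3'⟩ := h'
  refine ⟨h1.prodMk h1', ?_, min t0 t0', ?_⟩
  · intro a b
    obtain ⟨M, hM⟩ := h2 a b
    obtain ⟨M', hM'⟩ := h2' a b
    refine ⟨max M M', ?_⟩
    filter_upwards [hM, hM'] with t ht ht'
    exact max_le_max ht ht'
  · intro t ht
    simp [h3 t (ht.trans_le (min_le_left _ _)), h3' t (ht.trans_le (min_le_right _ _))]

/-! ### The abstract estimate at every starting time -/

/-- Shifted estimate, phrased through almost-everywhere bounds. -/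
def Sys (β : ℝ → ℝ → ℝ) (γu γy : ℝ → ℝ) (v z a : ℝ → ℝ) : Prop :=
  ∀ c : ℝ, ∀ᵐ s ∂(volume : Measure ℝ), c ≤ s → ∀ R V M : ℝ, 0 ≤ R → 0 ≤ V → 0 ≤ M →
    (∀ᵐ τ ∂(volume : Measure ℝ), τ ≤ c → v τ ≤ R) →
    (∀ᵐ τ ∂(volume : Measure ℝ), τ ≤ c → z τ ≤ R) →
    (∀ᵐ τ ∂(volume : Measure ℝ), c ≤ τ → τ ≤ s → v τ ≤ V) →
    (∀ᵐ τ ∂(volume : Measure ℝ), c ≤ τ → τ ≤ s → z τ ≤ M) →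
    a s ≤ max (β R (s - c)) (max (γu V) (γy M))

theorem sys_of_ios {U Y Z : Type*} [NormedAddCommGroup U] [NormedAddCommGroup Y]
    [NormedAddCommGroup Z] {F : (ℝ → U × Z) → ℝ → Y} (hs : ShiftInvariant F)
    {β : ℝ → ℝ → ℝ} {γu γy : ℝ → ℝ} (hβ : ClassKL β) (hγu : ClassK γu) (hγy : ClassK γy)
    (hIOS : ∀ (u : ℝ → U) (z : ℝ → Z), MemL0inf u → MemL0inf z →
      ∀ᵐ t ∂(volume.restrict (Ici (0:ℝ))),
        ‖F (fun s => (u s, z s)) t‖ ≤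
          max (β (essSupI (fun s => (u s, z s)) (Iic 0)) t)
            (max (γu (essSupI u (Icc 0 t))) (γy (essSupI z (Icc 0 t)))))
    {u : ℝ → U} {z : ℝ → Z} {y : ℝ → Y} (hu : MemL0inf u) (hz : MemL0inf z)
    (hy : ∀ᵐ t ∂(volume : Measure ℝ), y t = F (fun s => (u s, z s)) t) :
    Sys β γu γy (fun t => ‖u t‖) (fun t => ‖z t‖) (fun t => ‖y t‖) := by
  intro c
  have h1 := hIOS _ _ (hu.shift c) (hz.shift c)
  have hsh := hs _ (hu.prodMk hz) (-c)
  simp only [sub_neg_eq_add] at hsh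
  rw [hsh, ae_restrict_iff' measurableSet_Ici] at h1
  have h2 := (measurePreserving_add_right volume (-c)).quasiMeasurePreserving.ae h1
  have key : ∀ {P : ℝ → Prop}, (∀ᵐ τ ∂(volume : Measure ℝ), P τ) →
      ∀ᵐ τ ∂(volume : Measure ℝ), P (τ + c) := fun h =>
    (measurePreserving_add_right volume c).quasiMeasurePreserving.ae h
  filter_upwards [h2, hy] with s hs1 hys hcs R V M hR hV hM hvR hzR hvV hzM
  have hs2 := hs1 (by simp only [mem_Ici]; linarith)
  simp only [neg_add_cancel_right] at hs2
  have h0 : 0 ≤ s + -c := by linarith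
  rw [sub_eq_add_neg, hys]
  refine hs2.trans (max_le_max ?_ (max_le_max ?_ ?_))
  · refine (hβ.1 _ h0).mono (essSupI_nonneg _ _) (essSupI_le hR ?_)
    rw [ae_restrict_iff' measurableSet_Iic]
    filter_upwards [key hvR, key hzR] with τ h1 h2 hτ
    have hτ' : τ + c ≤ c := by linarith [mem_Iic.1 hτ]
    exact max_le (h1 hτ') (h2 hτ')
  · refine hγu.mono (essSupI_nonneg _ _) (essSupI_le hV ?_)
    rw [ae_restrict_iff' measurableSet_Icc]
    filter_upwards [key hvV] with τ h1 hτ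
    exact h1 (by linarith [hτ.1]) (by linarith [hτ.2])
  · refine hγy.mono (essSupI_nonneg _ _) (essSupI_le hM ?_)
    rw [ae_restrict_iff' measurableSet_Icc]
    filter_upwards [key hzM] with τ h1 hτ
    exact h1 (by linarith [hτ.1]) (by linarith [hτ.2])

theorem Sys.past {β : ℝ → ℝ → ℝ} {γu γy : ℝ → ℝ} {v z a : ℝ → ℝ} (h : Sys β γu γy v z a)
    (hβ : ClassKL β) (hγu : ClassK γu) {T0 : ℝ}
    (hv0 : ∀ t, t ≤ T0 → v t ≤ 0) (hz0 : ∀ t, t ≤ T0 → z t ≤ 0) (ha0 : ∀ t, t ≤ T0 → a t ≤ 0) :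
    ∀ᵐ s ∂(volume : Measure ℝ), ∀ V M : ℝ, 0 ≤ V → 0 ≤ M →
      (∀ᵐ τ ∂(volume : Measure ℝ), τ ≤ s → v τ ≤ V) →
      (∀ᵐ τ ∂(volume : Measure ℝ), τ ≤ s → z τ ≤ M) →
      a s ≤ max (γu V) (γy M) := by
  filter_upwards [h T0] with s hs V M hV hM h1 h2
  rcases le_total s T0 with hsT | hsT
  · exact (ha0 s hsT).trans (le_max_of_le_left (hγu.nonneg hV))
  · have := hs hsT 0 V M le_rfl hV hM (Eventually.of_forall hv0) (Eventually.of_forall hz0)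
      (h1.mono fun τ h _ h' => h h') (h2.mono fun τ h _ h' => h h')
    have h0 : β 0 (s - T0) = 0 := (hβ.1 (s - T0) (by linarith)).2.2.1
    rw [h0] at this
    exact this.trans (max_le (le_max_of_le_left (hγu.nonneg hV)) le_rfl)

theorem Sys.step {β : ℝ → ℝ → ℝ} {γu γy : ℝ → ℝ} {v z a : ℝ → ℝ} (h : Sys β γu γy v z a)
    (hβ : ClassKL β) {b c δ R V M : ℝ} (hc : 0 ≤ c) (hδ : 0 ≤ δ)
    (hR : 0 ≤ R) (hV : 0 ≤ V) (hM : 0 ≤ M)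
    (h1 : ∀ᵐ τ ∂(volume : Measure ℝ), τ ≤ b → v τ ≤ R)
    (h2 : ∀ᵐ τ ∂(volume : Measure ℝ), τ ≤ b → z τ ≤ R)
    (h3 : ∀ᵐ τ ∂(volume : Measure ℝ), 0 ≤ τ → τ ≤ b → v τ ≤ V)
    (h4 : ∀ᵐ τ ∂(volume : Measure ℝ), c ≤ τ → τ ≤ b → z τ ≤ M) :
    ∀ᵐ s ∂(volume : Measure ℝ), c + δ ≤ s → s ≤ b →
      a s ≤ max (β R δ) (max (γu V) (γy M)) := by
  filter_upwards [h c] with s hs hcs hsb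
  refine (hs (by linarith) R V M hR hV hM ?_ ?_ ?_ ?_).trans (max_le_max ?_ le_rfl)
  · exact h1.mono fun τ h h' => h (by linarith)
  · exact h2.mono fun τ h h' => h (by linarith)
  · exact h3.mono fun τ h h' h'' => h (by linarith) (by linarith)
  · exact h4.mono fun τ h h' h'' => h h' (by linarith)
  · exact (hβ.2 R hR).2.1 hδ (show (0:ℝ) ≤ s - c by linarith) (by linarith)

theorem past_bound {β1 β2 : ℝ → ℝ → ℝ} {γ1u γ1y γ2u γ2y : ℝ → ℝ} {v1 v2 a1 a2 : ℝ → ℝ}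
    (h1 : Sys β1 γ1u γ1y v1 a2 a1) (h2 : Sys β2 γ2u γ2y v2 a1 a2)
    (hβ1 : ClassKL β1) (hβ2 : ClassKL β2)
    (hγ1u : ClassK γ1u) (hγ1y : ClassK γ1y) (hγ2u : ClassK γ2u) (hγ2y : ClassK γ2y)
    (hsg : ∀ s : ℝ, 0 < s → γ1y (γ2y s) < s) {T0 : ℝ}
    (hv1 : ∀ t, t ≤ T0 → v1 t ≤ 0) (hv2 : ∀ t, t ≤ T0 → v2 t ≤ 0)
    (ha1 : ∀ t, t ≤ T0 → a1 t ≤ 0) (ha2 : ∀ t, t ≤ T0 → a2 t ≤ 0)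
    (hbd : ∀ b : ℝ, ∃ M : ℝ, 0 ≤ M ∧ ∀ᵐ t ∂(volume : Measure ℝ), t ≤ b → a1 t ≤ M)
    {b V : ℝ} (hV : 0 ≤ V)
    (hb1 : ∀ᵐ τ ∂(volume : Measure ℝ), τ ≤ b → v1 τ ≤ V)
    (hb2 : ∀ᵐ τ ∂(volume : Measure ℝ), τ ≤ b → v2 τ ≤ V) :
    ∀ᵐ τ ∂(volume : Measure ℝ), τ ≤ b → a1 τ ≤ max (γ1u V) (γ1y (γ2u V)) := by
  obtain ⟨M, hM0, hM⟩ := hbd b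
  have hκ : ClassK (fun s => γ1y (γ2y s)) := hγ1y.comp hγ2y
  set S := max (γ1u V) (γ1y (γ2u V)) with hS
  have hS0 : 0 ≤ S := le_max_of_le_left (hγ1u.nonneg hV)
  have claim : ∀ n : ℕ, ∀ᵐ τ ∂(volume : Measure ℝ), τ ≤ b →
      a1 τ ≤ max S ((fun s => γ1y (γ2y s))^[n] M) := by
    intro n
    induction n with
    | zero => exact hM.mono fun τ h h' => le_max_of_le_right (h h')
    | succ n ih =>
      set K := (fun s => γ1y (γ2y s))^[n] M with hK
      have hK0 : 0 ≤ K := (hκ.iterate n).nonneg hM0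
      have hm0 : 0 ≤ max S K := le_max_of_le_left hS0
      have e2 : ∀ᵐ τ ∂(volume : Measure ℝ), τ ≤ b → a2 τ ≤ max (γ2u V) (γ2y (max S K)) := by
        filter_upwards [h2.past hβ2 hγ2u hv2 ha1 ha2] with s hs hsb
        exact hs V _ hV hm0 (hb2.mono fun τ h h' => h (by linarith))
          (ih.mono fun τ h h' => h (by linarith))
      filter_upwards [h1.past hβ1 hγ1u hv1 ha2 ha1] with s hs hsb
      have := hs V _ hV (le_max_of_le_left (hγ2u.nonneg hV))
        (hb1.mono fun τ h h' => h (by linarith))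
        (e2.mono fun τ h h' => h (by linarith))
      refine this.trans ?_
      rw [Function.iterate_succ_apply', hγ2y.map_max hS0 hK0,
        hγ1y.map_max (hγ2u.nonneg hV) (le_max_of_le_left (hγ2y.nonneg hS0)),
        hγ1y.map_max (hγ2y.nonneg hS0) (hγ2y.nonneg hK0)]
      refine max_le (le_max_of_le_left (le_max_left _ _)) (max_le
        (le_max_of_le_left (le_max_right _ _)) (max_le
        (le_max_of_le_left (hκ.le_of_lt hsg hS0)) (le_max_right _ _)))
  have hall := ae_all_iff.2 claim
  filter_upwards [hall] with τ hτ hτb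
  have ht := (tendsto_const_nhds (x := S)).max (hκ.iterate_tendsto hsg hM0)
  rw [max_eq_left hS0] at ht
  exact ge_of_tendsto' ht (fun n => hτ n hτb)

theorem decay_bound {β1 β2 : ℝ → ℝ → ℝ} {γ1u γ1y γ2u γ2y : ℝ → ℝ} {v1 v2 a1 a2 : ℝ → ℝ}
    (h1 : Sys β1 γ1u γ1y v1 a2 a1) (h2 : Sys β2 γ2u γ2y v2 a1 a2)
    (hβ1 : ClassKL β1) (hβ2 : ClassKL β2)
    (hγ1u : ClassK γ1u) (hγ1y : ClassK γ1y) (hγ2u : ClassK γ2u) (hγ2y : ClassK γ2y)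
    (hsg : ∀ s : ℝ, 0 < s → γ1y (γ2y s) < s)
    {b R V δ : ℝ} (hR : 0 ≤ R) (hV : 0 ≤ V) (hδ : 0 ≤ δ)
    (hb1 : ∀ᵐ τ ∂(volume : Measure ℝ), τ ≤ b → v1 τ ≤ R)
    (hb2 : ∀ᵐ τ ∂(volume : Measure ℝ), τ ≤ b → v2 τ ≤ R)
    (hb3 : ∀ᵐ τ ∂(volume : Measure ℝ), τ ≤ b → a1 τ ≤ R)
    (hb4 : ∀ᵐ τ ∂(volume : Measure ℝ), τ ≤ b → a2 τ ≤ R)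
    (hc1 : ∀ᵐ τ ∂(volume : Measure ℝ), 0 ≤ τ → τ ≤ b → v1 τ ≤ V)
    (hc2 : ∀ᵐ τ ∂(volume : Measure ℝ), 0 ≤ τ → τ ≤ b → v2 τ ≤ V) (n : ℕ) :
    ∀ᵐ τ ∂(volume : Measure ℝ), 2 * n * δ ≤ τ → τ ≤ b →
      a1 τ ≤ max (max (max (β1 R δ) (γ1y (β2 R δ))) (max (γ1u V) (γ1y (γ2u V))))
        ((fun s => γ1y (γ2y s))^[n] R) := by
  have hκ : ClassK (fun s => γ1y (γ2y s)) := hγ1y.comp hγ2y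
  set D := max (max (β1 R δ) (γ1y (β2 R δ))) (max (γ1u V) (γ1y (γ2u V))) with hD
  have hD0 : 0 ≤ D := le_max_of_le_right (le_max_of_le_left (hγ1u.nonneg hV))
  have d1 : β1 R δ ≤ D := le_max_of_le_left (le_max_left _ _)
  have d2 : γ1y (β2 R δ) ≤ D := le_max_of_le_left (le_max_right _ _)
  have d3 : γ1u V ≤ D := le_max_of_le_right (le_max_left _ _)
  have d4 : γ1y (γ2u V) ≤ D := le_max_of_le_right (le_max_right _ _)
  induction n with
  | zero => exact hb3.mono fun τ h _ h' => le_max_of_le_right (h h')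
  | succ n ih =>
    set K := (fun s => γ1y (γ2y s))^[n] R with hK
    have hK0 : 0 ≤ K := (hκ.iterate n).nonneg hR
    have hm0 : 0 ≤ max D K := le_max_of_le_left hD0
    have hB0 : 0 ≤ β2 R δ := hβ2.nonneg hR hδ
    have hG0 : 0 ≤ γ2u V := hγ2u.nonneg hV
    have hn : (0:ℝ) ≤ 2 * n * δ := by positivity
    have e2 := h2.step hβ2 hn hδ hR hV hm0 hb2 hb3 hc2 ih
    have e1 := h1.step hβ1 (add_nonneg hn hδ) hδ hR hV (le_max_of_le_left hB0) hb1 hb4 hc1 e2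
    filter_upwards [e1] with s hs hs1 hsb
    refine (hs (by push_cast at hs1; linarith) hsb).trans ?_
    rw [Function.iterate_succ_apply', hγ2y.map_max hD0 hK0,
      hγ1y.map_max hB0 (le_max_of_le_left hG0),
      hγ1y.map_max hG0 (le_max_of_le_left (hγ2y.nonneg hD0)),
      hγ1y.map_max (hγ2y.nonneg hD0) (hγ2y.nonneg hK0)]
    exact max_le (le_max_of_le_left d1) (max_le (le_max_of_le_left d3)
      (max_le (le_max_of_le_left d2) (max_le (le_max_of_le_left d4)
        (max_le (le_max_of_le_left (hκ.le_of_lt hsg hD0)) (le_max_right _ _)))))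

/-! ### Interpolation: building a class KL function from a sequence of class K functions -/

/-- The ramp function. -/
noncomputable def ramp (x : ℝ) : ℝ := max 0 (min 1 x)

/-- Partial interpolation sum. -/
noncomputable def interpSum (a : ℕ → ℝ) (M : ℕ) (t : ℝ) : ℝ :=
  a 0 + ∑ k ∈ Finset.range M, (a (k + 1) - a k) * ramp (t - k)

/-- Piecewise linear interpolation of a sequence. -/
noncomputable def interp (a : ℕ → ℝ) (t : ℝ) : ℝ := interpSum a (⌊t⌋₊ + 1) t

theorem interpSum_eq (a : ℕ → ℝ) {t : ℝ} {M M' : ℕ} (h : t ≤ M) (hM : M ≤ M') :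
    interpSum a M' t = interpSum a M t := by
  induction M', hM using Nat.le_induction with
  | base => rfl
  | succ n hn ih =>
    rw [← ih]
    unfold interpSum
    rw [Finset.sum_range_succ]
    have : ramp (t - n) = 0 := by
      unfold ramp
      have : (M:ℝ) ≤ n := by exact_mod_cast hn
      exact max_eq_left ((min_le_right _ _).trans (by linarith))
    rw [this]; ring

theorem interp_eq_sum (a : ℕ → ℝ) {t : ℝ} {M : ℕ} (h : t < M) (hM : 0 < M) :
    interp a t = interpSum a M t := by
  unfold interp
  rw [eq_comm]
  apply interpSum_eq a
  · push_cast; exact (Nat.lt_floor_add_one t).le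
  · rcases le_or_gt 0 t with h0 | h0
    · exact Nat.succ_le_of_lt ((Nat.floor_lt h0).2 h)
    · rw [Nat.floor_of_nonpos h0.le]
      omega

theorem interp_continuous (a : ℕ → ℝ) : ContinuousOn (interp a) (Ici 0) := by
  intro t ht
  obtain ⟨M, hM⟩ := exists_nat_gt t
  have hM0 : 0 < M := by
    have : (0:ℝ) < M := lt_of_le_of_lt ht hM
    exact_mod_cast this
  have hc : Continuous (interpSum a M) := by
    unfold interpSum ramp
    fun_prop
  apply ContinuousAt.continuousWithinAt
  refine hc.continuousAt.congr ?_
  filter_upwards [Iio_mem_nhds hM] with s hs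
  exact (interp_eq_sum a hs hM0).symm

theorem interp_antitone {a : ℕ → ℝ} (ha : Antitone a) : AntitoneOn (interp a) (Ici 0) := by
  intro s hs t ht hst
  obtain ⟨M, hM⟩ := exists_nat_gt t
  have hM0 : 0 < M := by
    have : (0:ℝ) < M := lt_of_le_of_lt ht hM
    exact_mod_cast this
  rw [interp_eq_sum a hM hM0, interp_eq_sum a (hst.trans_lt hM) hM0]
  unfold interpSum
  refine add_le_add le_rfl (Finset.sum_le_sum fun k hk => ?_)
  have h1 : a (k+1) - a k ≤ 0 := sub_nonpos.2 (ha (Nat.le_succ k))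
  apply mul_le_mul_of_nonpos_left _ h1
  unfold ramp
  gcongr

theorem interpSum_full (a : ℕ → ℝ) {t : ℝ} {n : ℕ} (h : (n:ℝ) ≤ t) : interpSum a n t = a n := by
  have : ∀ k ∈ Finset.range n, (a (k + 1) - a k) * ramp (t - k) = a (k+1) - a k := by
    intro k hk
    have hk' : ((k + 1 : ℕ) : ℝ) ≤ n := by exact_mod_cast Finset.mem_range.1 hk
    push_cast at hk'
    have : ramp (t - k) = 1 := by
      unfold ramp
      rw [min_eq_left (by linarith)]; simp
    rw [this, mul_one]
  unfold interpSum
  rw [Finset.sum_congr rfl this, Finset.sum_range_sub]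
  ring

theorem interp_formula (a : ℕ → ℝ) {t : ℝ} (h : 0 ≤ t) :
    interp a t = (1 - (t - ⌊t⌋₊)) * a ⌊t⌋₊ + (t - ⌊t⌋₊) * a (⌊t⌋₊ + 1) := by
  have h1 := Nat.floor_le h
  have h2 := Nat.lt_floor_add_one t
  have h3 := interpSum_full a h1
  unfold interp
  unfold interpSum at h3 ⊢
  rw [Finset.sum_range_succ, ← add_assoc, h3]
  have : ramp (t - ⌊t⌋₊) = t - ⌊t⌋₊ := by
    unfold ramp
    rw [min_eq_right (by linarith), max_eq_right (by linarith)]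
  rw [this]; ring

theorem interp_le {a : ℕ → ℝ} (ha : Antitone a) {t : ℝ} (h : 0 ≤ t) :
    interp a t ≤ a ⌊t⌋₊ := by
  rw [interp_formula a h]
  nlinarith [Nat.floor_le h, ha (Nat.le_succ ⌊t⌋₊)]

theorem le_interp {a : ℕ → ℝ} (ha : Antitone a) {t : ℝ} (h : 0 ≤ t) :
    a (⌊t⌋₊ + 1) ≤ interp a t := by
  rw [interp_formula a h]
  nlinarith [Nat.lt_floor_add_one t, ha (Nat.le_succ ⌊t⌋₊)]

theorem exists_KL {φ : ℕ → ℝ → ℝ} (hK : ∀ n, ClassK (φ n))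
    (hanti : ∀ r, 0 ≤ r → Antitone (fun n => φ n r))
    (hlim : ∀ r, 0 ≤ r → Tendsto (fun n => φ n r) atTop (nhds 0)) :
    ∃ β : ℝ → ℝ → ℝ, ClassKL β ∧ ∀ r t, 0 ≤ r → 0 ≤ t → φ ⌊t⌋₊ r ≤ β r t := by
  have hanti' : ∀ r, 0 ≤ r → Antitone (fun n => φ (n - 1) r) := fun r hr m n hmn =>
    hanti r hr (Nat.sub_le_sub_right hmn 1)
  refine ⟨fun r t => interp (fun n => φ (n - 1) r) t, ⟨?_, ?_⟩, ?_⟩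
  · intro t ht
    simp only [interp_formula _ ht]
    set n := ⌊t⌋₊
    have h1 : 0 ≤ t - n := sub_nonneg.2 (Nat.floor_le ht)
    have h2 : 0 < 1 - (t - n) := by linarith [Nat.lt_floor_add_one t]
    obtain ⟨c1, m1, z1, p1⟩ := hK (n - 1)
    obtain ⟨c2, m2, z2, p2⟩ := hK (n + 1 - 1)
    refine ⟨by fun_prop, ?_, by beta_reduce; rw [z1, z2]; ring, ?_⟩
    · intro x hx y hy hxy
      have := m1 hx hy hxy
      have := (m2 hx hy hxy).le
      exact add_lt_add_of_lt_of_le (by gcongr) (by gcongr)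
    · intro s hs
      have := p1 s hs
      have := p2 s hs
      positivity
  · intro r hr
    refine ⟨interp_continuous _, interp_antitone (hanti' r hr), ?_⟩
    have hl : Tendsto (fun n => φ (n - 1) r) atTop (nhds 0) :=
      (hlim r hr).comp (tendsto_sub_atTop_nat 1)
    refine tendsto_of_tendsto_of_tendsto_of_le_of_le' tendsto_const_nhds
      (hl.comp tendsto_nat_floor_atTop) ?_ ?_
    · filter_upwards [eventually_ge_atTop 0] with t ht
      exact ((hK _).nonneg hr).trans (le_interp (hanti' r hr) ht)
    · filter_upwards [eventually_ge_atTop 0] with t ht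
      exact interp_le (hanti' r hr) ht
  · intro r t hr ht
    exact le_interp (hanti' r hr) ht

theorem sg_swap {f g : ℝ → ℝ} (hf : ClassK f) (hg : ClassK g) (h : ∀ s, 0 < s → f (g s) < s) :
    ∀ s, 0 < s → g (f s) < s := by
  intro s hs
  by_contra hc
  push Not at hc
  have h0 : 0 < f s := by
    have := hf.2.1 (self_mem_Ici) hs.le hs
    rwa [hf.2.2.1] at this
  exact absurd (h (f s) h0) (not_lt.2 (hf.mono hs.le hc))

/-- Decay bound function. -/
noncomputable def phi (β1 β2 : ℝ → ℝ → ℝ) (γ1y γ2y : ℝ → ℝ) (m : ℕ) (R : ℝ) : ℝ :=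
  max (β1 R m) (γ1y (max (max (β2 R m) (γ2y (β1 R m))) ((fun s => γ2y (γ1y s))^[m] R)))

theorem phi_K {β1 β2 : ℝ → ℝ → ℝ} {γ1y γ2y : ℝ → ℝ} (hβ1 : ClassKL β1) (hβ2 : ClassKL β2)
    (hγ1y : ClassK γ1y) (hγ2y : ClassK γ2y) (m : ℕ) : ClassK (phi β1 β2 γ1y γ2y m) := by
  have hb1 := hβ1.1 m m.cast_nonneg
  have hb2 := hβ2.1 m m.cast_nonneg
  exact hb1.max (hγ1y.comp ((hb2.max (hγ2y.comp hb1)).max ((hγ2y.comp hγ1y).iterate m)))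

theorem phi_anti {β1 β2 : ℝ → ℝ → ℝ} {γ1y γ2y : ℝ → ℝ} (hβ1 : ClassKL β1) (hβ2 : ClassKL β2)
    (hγ1y : ClassK γ1y) (hγ2y : ClassK γ2y) (hsg : ∀ s : ℝ, 0 < s → γ2y (γ1y s) < s)
    {r : ℝ} (hr : 0 ≤ r) : Antitone (fun m => phi β1 β2 γ1y γ2y m r) := by
  intro m n hmn
  have hc : (m:ℝ) ≤ n := by exact_mod_cast hmn
  have e1 : β1 r n ≤ β1 r m := (hβ1.2 r hr).2.1 (mem_Ici.2 m.cast_nonneg) (mem_Ici.2 n.cast_nonneg) hc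
  have e2 : β2 r n ≤ β2 r m := (hβ2.2 r hr).2.1 (mem_Ici.2 m.cast_nonneg) (mem_Ici.2 n.cast_nonneg) hc
  have hb1 := hβ1.nonneg hr (n.cast_nonneg)
  have hb2 := hβ2.nonneg hr (n.cast_nonneg)
  have e3 := (hγ2y.comp hγ1y).iterate_antitone hsg hr hmn
  exact max_le_max e1 (hγ1y.mono (le_max_of_le_left (le_max_of_le_left hb2))
    (max_le_max (max_le_max e2 (hγ2y.mono hb1 e1)) e3))

theorem phi_lim {β1 β2 : ℝ → ℝ → ℝ} {γ1y γ2y : ℝ → ℝ} (hβ1 : ClassKL β1) (hβ2 : ClassKL β2)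
    (hγ1y : ClassK γ1y) (hγ2y : ClassK γ2y) (hsg : ∀ s : ℝ, 0 < s → γ2y (γ1y s) < s)
    {r : ℝ} (hr : 0 ≤ r) : Tendsto (fun m => phi β1 β2 γ1y γ2y m r) atTop (nhds 0) := by
  have l1 : Tendsto (fun m : ℕ => β1 r m) atTop (nhds 0) :=
    (hβ1.2 r hr).2.2.comp tendsto_natCast_atTop_atTop
  have l2 : Tendsto (fun m : ℕ => β2 r m) atTop (nhds 0) :=
    (hβ2.2 r hr).2.2.comp tendsto_natCast_atTop_atTop
  have l3 := (hγ2y.comp hγ1y).iterate_tendsto hsg hr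
  have l4 := hγ2y.tendsto_zero l1 (fun m => hβ1.nonneg hr m.cast_nonneg)
  have l5 := (l2.max l4).max l3
  simp only [max_self] at l5
  have l6 := hγ1y.tendsto_zero l5 (fun m => le_max_of_le_left (le_max_of_le_left
    (hβ2.nonneg hr m.cast_nonneg)))
  have := l1.max l6
  simp only [max_self] at this
  exact this

/-- Pointwise bound with decay, from all natural starting times. -/
theorem decay_point {β1 β2 : ℝ → ℝ → ℝ} {γ1u γ1y γ2u γ2y : ℝ → ℝ} {v1 v2 a1 a2 : ℝ → ℝ}
    (h1 : Sys β1 γ1u γ1y v1 a2 a1) (h2 : Sys β2 γ2u γ2y v2 a1 a2)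
    (hβ1 : ClassKL β1) (hβ2 : ClassKL β2)
    (hγ1u : ClassK γ1u) (hγ1y : ClassK γ1y) (hγ2u : ClassK γ2u) (hγ2y : ClassK γ2y)
    (hsg : ∀ s : ℝ, 0 < s → γ2y (γ1y s) < s) :
    ∀ᵐ t ∂(volume : Measure ℝ), ∀ (R V : ℝ) (m : ℕ), 0 ≤ R → 0 ≤ V → (3 * m * m : ℝ) ≤ t →
      (∀ᵐ τ ∂(volume : Measure ℝ), τ ≤ t → v1 τ ≤ R) →
      (∀ᵐ τ ∂(volume : Measure ℝ), τ ≤ t → v2 τ ≤ R) →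
      (∀ᵐ τ ∂(volume : Measure ℝ), τ ≤ t → a1 τ ≤ R) →
      (∀ᵐ τ ∂(volume : Measure ℝ), τ ≤ t → a2 τ ≤ R) →
      (∀ᵐ τ ∂(volume : Measure ℝ), 0 ≤ τ → τ ≤ t → v1 τ ≤ V) →
      (∀ᵐ τ ∂(volume : Measure ℝ), 0 ≤ τ → τ ≤ t → v2 τ ≤ V) →
      a1 t ≤ max (phi β1 β2 γ1y γ2y m R)
        (max (γ1u V) (γ1y (max (γ2u V) (γ2y (γ1u V))))) := by
  have hall := ae_all_iff.2 (fun n : ℕ => h1 (n : ℝ))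
  filter_upwards [hall] with t ht R V m hR hV hmt e1 e2 e3 e4 e5 e6
  have hd := decay_bound h2 h1 hβ2 hβ1 hγ2u hγ2y hγ1u hγ1y hsg hR hV (m.cast_nonneg (α := ℝ))
    e2 e1 e4 e3 e6 e5 m
  have hmm : (m:ℝ) ≤ m * m := by exact_mod_cast Nat.le_mul_self m
  have hB2 := hβ2.nonneg hR m.cast_nonneg
  have hB1 := hβ1.nonneg hR m.cast_nonneg
  have hG := hγ1u.nonneg hV
  have hG2 := hγ2u.nonneg hV
  have hK0 := ((hγ2y.comp hγ1y).iterate m).nonneg hR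
  set A := max (β2 R m) (γ2y (β1 R m)) with hA
  set C := max (γ2u V) (γ2y (γ1u V)) with hC
  set K := (fun s => γ2y (γ1y s))^[m] R with hK
  have hA0 : 0 ≤ A := le_max_of_le_left hB2
  have hC0 : 0 ≤ C := le_max_of_le_left hG2
  have hle : ((2 * m * m : ℕ) : ℝ) ≤ t := by push_cast; nlinarith
  have := ht (2 * m * m) hle R V (max (max A C) K) hR hV (le_max_of_le_right hK0)
    (e1.mono fun τ h h' => h (h'.trans hle)) (e4.mono fun τ h h' => h (h'.trans hle))
    (e5.mono fun τ h h' h'' => h ((Nat.cast_nonneg _).trans h') h'')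
    (hd.mono fun τ h h' h'' => h (by push_cast at h'; exact h') h'')
  refine this.trans ?_
  have hb : β1 R (t - (2 * m * m : ℕ)) ≤ β1 R m :=
    (hβ1.2 R hR).2.1 (mem_Ici.2 m.cast_nonneg) (show (0:ℝ) ≤ t - (2 * m * m : ℕ) by linarith)
      (by push_cast; nlinarith)
  have hp : phi β1 β2 γ1y γ2y m R = max (β1 R m) (γ1y (max A K)) := rfl
  rw [hp, hγ1y.map_max (le_max_of_le_left hA0) hK0, hγ1y.map_max hA0 hC0, hγ1y.map_max hA0 hK0]
  refine max_le (hb.trans (le_max_of_le_left (le_max_left _ _))) (max_le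
    (le_max_of_le_right (le_max_left _ _)) (max_le (max_le ?_ ?_) ?_))
  · exact le_max_of_le_left (le_max_of_le_right (le_max_left _ _))
  · exact le_max_of_le_right (le_max_right _ _)
  · exact le_max_of_le_left (le_max_of_le_right (le_max_right _ _))

/-- **Small-gain theorem for input/output operators** (Corollary 4.8).  Products of
normed spaces carry the norm `‖(s₁,s₂)‖ = max {‖s₁‖, ‖s₂‖}` (Mathlib's `Prod` norm),
and pairs of signals are identified with `fun t => (w₁ t, w₂ t)`. -/
theorem small_gain_io_operators
    {U1 U2 Y1 Y2 : Type*}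
    [NormedAddCommGroup U1] [NormedSpace ℝ U1]
    [NormedAddCommGroup U2] [NormedSpace ℝ U2]
    [NormedAddCommGroup Y1] [NormedSpace ℝ Y1]
    [NormedAddCommGroup Y2] [NormedSpace ℝ Y2]
    (F1 : (ℝ → U1 × Y2) → ℝ → Y1) (F2 : (ℝ → U2 × Y1) → ℝ → Y2)
    (hF1m : ∀ w, MemL0inf w → MemL0inf (F1 w)) (hF1c : Causal F1)
    (hF1s : ShiftInvariant F1)
    (hF2m : ∀ w, MemL0inf w → MemL0inf (F2 w)) (hF2c : Causal F2)
    (hF2s : ShiftInvariant F2)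
    (β1 β2 : ℝ → ℝ → ℝ) (hβ1 : ClassKL β1) (hβ2 : ClassKL β2)
    (γ1u γ1y γ2u γ2y : ℝ → ℝ)
    (hγ1u : ClassK γ1u) (hγ1y : ClassK γ1y) (hγ2u : ClassK γ2u) (hγ2y : ClassK γ2y)
    (hIOS1 : ∀ (u1 : ℝ → U1) (y2 : ℝ → Y2), MemL0inf u1 → MemL0inf y2 →
      ∀ᵐ t ∂(volume.restrict (Ici (0:ℝ))),
        ‖F1 (fun s => (u1 s, y2 s)) t‖ ≤
          max (β1 (essSupI (fun s => (u1 s, y2 s)) (Iic 0)) t)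
            (max (γ1u (essSupI u1 (Icc 0 t))) (γ1y (essSupI y2 (Icc 0 t)))))
    (hIOS2 : ∀ (u2 : ℝ → U2) (y1 : ℝ → Y1), MemL0inf u2 → MemL0inf y1 →
      ∀ᵐ t ∂(volume.restrict (Ici (0:ℝ))),
        ‖F2 (fun s => (u2 s, y1 s)) t‖ ≤
          max (β2 (essSupI (fun s => (u2 s, y1 s)) (Iic 0)) t)
            (max (γ2u (essSupI u2 (Icc 0 t))) (γ2y (essSupI y1 (Icc 0 t)))))
    (hsg : (∀ s : ℝ, 0 < s → γ1y (γ2y s) < s) ∨ (∀ s : ℝ, 0 < s → γ2y (γ1y s) < s)) :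
    ∃ β : ℝ → ℝ → ℝ, ∃ γ : ℝ → ℝ, ClassKL β ∧ ClassK γ ∧
      ∀ (u1 : ℝ → U1) (u2 : ℝ → U2) (y1 : ℝ → Y1) (y2 : ℝ → Y2),
        MemL0inf u1 → MemL0inf u2 → MemL0inf y1 → MemL0inf y2 →
        (∀ᵐ t ∂(volume : Measure ℝ),
          y1 t = F1 (fun s => (u1 s, y2 s)) t ∧ y2 t = F2 (fun s => (u2 s, y1 s)) t) →
        ∀ᵐ t ∂(volume.restrict (Ici (0:ℝ))),
          max ‖y1 t‖ ‖y2 t‖ ≤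
            max (β (essSupI (fun s => (u1 s, u2 s)) (Iic 0)) t)
              (γ (essSupI (fun s => (u1 s, u2 s)) (Icc 0 t))) := by
  have hsg1 : ∀ s : ℝ, 0 < s → γ1y (γ2y s) < s := by
    rcases hsg with h | h
    · exact h
    · exact sg_swap hγ2y hγ1y h
  have hsg2 : ∀ s : ℝ, 0 < s → γ2y (γ1y s) < s := sg_swap hγ1y hγ2y hsg1
  clear hsg
  -- the bounds on the whole past
  set σ1 : ℝ → ℝ := fun s => max (γ1u s) (γ1y (γ2u s)) with hσ1
  set σ2 : ℝ → ℝ := fun s => max (γ2u s) (γ2y (γ1u s)) with hσ2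
  have kσ1 : ClassK σ1 := hγ1u.max (hγ1y.comp hγ2u)
  have kσ2 : ClassK σ2 := hγ2u.max (hγ2y.comp hγ1u)
  set ρ : ℝ → ℝ := fun s => max s (max (σ1 s) (σ2 s)) with hρ
  have kρ : ClassK ρ := ClassK.id.max (kσ1.max kσ2)
  set γ : ℝ → ℝ := fun s => max (max (γ1u s) (γ1y (σ2 s))) (max (γ2u s) (γ2y (σ1 s))) with hγ
  have kγ : ClassK γ := (hγ1u.max (hγ1y.comp kσ2)).max (hγ2u.max (hγ2y.comp kσ1))
  set m : ℕ → ℕ := fun N => Nat.sqrt (N / 3) with hm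
  have m_mono : Monotone m := fun a b h => Nat.sqrt_le_sqrt (Nat.div_le_div_right h)
  have m_le : ∀ N, 3 * m N * m N ≤ N := by
    intro N
    have h1 := Nat.sqrt_le (N / 3)
    have h2 : 3 * (N / 3) ≤ N := Nat.mul_div_le N 3
    calc 3 * m N * m N = 3 * (m N * m N) := by ring
      _ ≤ 3 * (N / 3) := Nat.mul_le_mul_left 3 h1
      _ ≤ N := h2
  have m_lim : Tendsto m atTop atTop := by
    refine tendsto_atTop_atTop.2 fun b => ⟨3 * (b * b), fun N hN => ?_⟩
    refine Nat.le_sqrt.2 ?_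
    omega
  obtain ⟨β, kβ, hβ⟩ := exists_KL
    (φ := fun N r => max (phi β1 β2 γ1y γ2y (m N) (ρ r)) (phi β2 β1 γ2y γ1y (m N) (ρ r)))
    (fun N => ((phi_K hβ1 hβ2 hγ1y hγ2y _).comp kρ).max ((phi_K hβ2 hβ1 hγ2y hγ1y _).comp kρ))
    (fun r hr a b hab => max_le_max
      (phi_anti hβ1 hβ2 hγ1y hγ2y hsg2 (kρ.nonneg hr) (m_mono hab))
      (phi_anti hβ2 hβ1 hγ2y hγ1y hsg1 (kρ.nonneg hr) (m_mono hab)))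
    (fun r hr => by
      have := ((phi_lim hβ1 hβ2 hγ1y hγ2y hsg2 (kρ.nonneg hr)).comp m_lim).max
        ((phi_lim hβ2 hβ1 hγ2y hγ1y hsg1 (kρ.nonneg hr)).comp m_lim)
      rw [max_self] at this
      exact this)
  refine ⟨β, γ, kβ, kγ, ?_⟩
  intro u1 u2 y1 y2 hu1 hu2 hy1 hy2 heq
  have s1 := sys_of_ios hF1s hβ1 hγ1u hγ1y hIOS1 hu1 hy2 (heq.mono fun _ h => h.1)
  have s2 := sys_of_ios hF2s hβ2 hγ2u hγ2y hIOS2 hu2 hy1 (heq.mono fun _ h => h.2)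
  obtain ⟨T0, z1, z2, z3, z4⟩ : ∃ T0 : ℝ, (∀ t, t ≤ T0 → ‖u1 t‖ ≤ 0) ∧
      (∀ t, t ≤ T0 → ‖u2 t‖ ≤ 0) ∧ (∀ t, t ≤ T0 → ‖y1 t‖ ≤ 0) ∧ (∀ t, t ≤ T0 → ‖y2 t‖ ≤ 0) := by
    obtain ⟨-, -, t1, h1⟩ := hu1
    obtain ⟨-, -, t2, h2⟩ := hu2
    obtain ⟨-, -, t3, h3⟩ := hy1
    obtain ⟨-, -, t4, h4⟩ := hy2
    refine ⟨min (min t1 t2) (min t3 t4) - 1, ?_, ?_, ?_, ?_⟩ <;> intro t ht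
    · rw [h1 t, norm_zero]
      linarith [min_le_left (min t1 t2) (min t3 t4), min_le_left t1 t2]
    · rw [h2 t, norm_zero]
      linarith [min_le_left (min t1 t2) (min t3 t4), min_le_right t1 t2]
    · rw [h3 t, norm_zero]
      linarith [min_le_right (min t1 t2) (min t3 t4), min_le_left t3 t4]
    · rw [h4 t, norm_zero]
      linarith [min_le_right (min t1 t2) (min t3 t4), min_le_right t3 t4]
  have pb1 := fun {b V : ℝ} (hV : 0 ≤ V) hb1 hb2 => past_bound s1 s2 hβ1 hβ2 hγ1u hγ1y hγ2u hγ2y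
    hsg1 z1 z2 z3 z4 (fun b => hy1.bdd b) (b := b) (V := V) hV hb1 hb2
  have pb2 := fun {b V : ℝ} (hV : 0 ≤ V) hb1 hb2 => past_bound s2 s1 hβ2 hβ1 hγ2u hγ2y hγ1u hγ1y
    hsg2 z2 z1 z4 z3 (fun b => hy2.bdd b) (b := b) (V := V) hV hb2 hb1
  have hu := hu1.prodMk hu2
  set w : ℝ → U1 × U2 := fun s => (u1 s, u2 s) with hw
  set U0 := essSupI w (Iic 0) with hU0
  have hU0n : 0 ≤ U0 := essSupI_nonneg _ _
  have hpast : ∀ᵐ τ ∂(volume : Measure ℝ), τ ≤ 0 → ‖w τ‖ ≤ U0 := by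
    obtain ⟨M, -, hM⟩ := hu.bdd 0
    have := ae_le_essSupI (w := w) (I := Iic 0) (M := M)
      ((ae_restrict_iff' measurableSet_Iic).2 hM)
    exact (ae_restrict_iff' measurableSet_Iic).1 this
  rw [ae_restrict_iff' measurableSet_Ici]
  filter_upwards [s1.past hβ1 hγ1u z1 z4 z3, s2.past hβ2 hγ2u z2 z3 z4,
    decay_point s1 s2 hβ1 hβ2 hγ1u hγ1y hγ2u hγ2y hsg2,
    decay_point s2 s1 hβ2 hβ1 hγ2u hγ2y hγ1u hγ1y hsg1] with t p1 p2 d1 d2 ht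
  have ht0 : 0 ≤ t := ht
  set V := essSupI w (Icc 0 t) with hVdef
  have hV : 0 ≤ V := essSupI_nonneg _ _
  have hnow : ∀ᵐ τ ∂(volume : Measure ℝ), 0 ≤ τ → τ ≤ t → ‖w τ‖ ≤ V := by
    obtain ⟨M, hM⟩ := hu.2.1 0 t
    have := (ae_restrict_iff' measurableSet_Icc).1 (ae_le_essSupI hM)
    exact this.mono fun τ h h' h'' => h ⟨h', h''⟩
  have w1 : ∀ τ, ‖u1 τ‖ ≤ ‖w τ‖ := fun τ => le_max_left _ _
  have w2 : ∀ τ, ‖u2 τ‖ ≤ ‖w τ‖ := fun τ => le_max_right _ _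
  have hW : ∀ᵐ τ ∂(volume : Measure ℝ), τ ≤ t → ‖w τ‖ ≤ max U0 V := by
    filter_upwards [hpast, hnow] with τ h1 h2 hτ
    rcases le_total τ 0 with h | h
    · exact le_max_of_le_left (h1 h)
    · exact le_max_of_le_right (h2 h hτ)
  have hW0 : 0 ≤ max U0 V := le_max_of_le_left hU0n
  have hW1 : ∀ᵐ τ ∂(volume : Measure ℝ), τ ≤ t → ‖u1 τ‖ ≤ max U0 V :=
    hW.mono fun τ h h' => (w1 τ).trans (h h')
  have hW2 : ∀ᵐ τ ∂(volume : Measure ℝ), τ ≤ t → ‖u2 τ‖ ≤ max U0 V :=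
    hW.mono fun τ h h' => (w2 τ).trans (h h')
  have b1 := pb1 hW0 hW1 hW2
  have b2 := pb2 hW0 hW1 hW2
  rcases le_total U0 V with hc | hc
  · rw [max_eq_right hc] at hW1 hW2 b1 b2
    have q1 := p1 V (σ2 V) hV (kσ2.nonneg hV) hW1 b2
    have q2 := p2 V (σ1 V) hV (kσ1.nonneg hV) hW2 b1
    exact le_max_of_le_right (max_le_max q1 q2)
  · rw [max_eq_left hc] at hW1 hW2 b1 b2
    have r0 : U0 ≤ ρ U0 := le_max_left _ _
    have r1 : σ1 U0 ≤ ρ U0 := le_max_of_le_right (le_max_left _ _)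
    have r2 : σ2 U0 ≤ ρ U0 := le_max_of_le_right (le_max_right _ _)
    have f1 := hW1.mono fun τ h h' => (h h').trans r0
    have f2 := hW2.mono fun τ h h' => (h h').trans r0
    have f3 := b1.mono fun τ h h' => (h h').trans r1
    have f4 := b2.mono fun τ h h' => (h h').trans r2
    have f5 := hnow.mono fun τ h h' h'' => (w1 τ).trans (h h' h'')
    have f6 := hnow.mono fun τ h h' h'' => (w2 τ).trans (h h' h'')
    have hmt : (3 * m ⌊t⌋₊ * m ⌊t⌋₊ : ℝ) ≤ t := by
      refine le_trans ?_ (Nat.floor_le ht0)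
      exact_mod_cast m_le ⌊t⌋₊
    have q1 := d1 (ρ U0) V (m ⌊t⌋₊) (kρ.nonneg hU0n) hV hmt f1 f2 f3 f4 f5 f6
    have q2 := d2 (ρ U0) V (m ⌊t⌋₊) (kρ.nonneg hU0n) hV hmt f2 f1 f4 f3 f6 f5
    have hb := hβ U0 t hU0n ht0
    refine max_le (q1.trans (max_le_max ?_ (le_max_left _ _)))
      (q2.trans (max_le_max ?_ (le_max_right _ _)))
    · exact (le_max_left _ _).trans hb
    · exact (le_max_right _ _).trans hb
end
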